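/- arXiv:2304.11613 — 2 statements merged into one kernel-verified Lean document; each statement's English description precedes it below -/
import Mathlib

section
/- The infinitely-branching property is not definable in any of the logics MSO, MTL, MPL, and WMPL: for none of these logics is there a sentence φ such that a Kripke tree (T, Lab) satisfies φ if and only if T is infinitely-branching (i.e., some node of T has infinitely many children in T). -/
/-! ## Trees over ℕ* -/

abbrev Node : Type := List ℕ

/-- `T` is a tree with root `r`: `r ∈ T`, every node extends `r`, and `T` is
prefix-closed above `r`. -/
def IsTreeRooted (T : Set Node) (r : Node) : Prop :=
  r ∈ T ∧ (∀ τ ∈ T, r <+: τ) ∧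
    ∀ σ σ' : List ℕ, r ++ σ ∈ T → σ' <+: σ → r ++ σ' ∈ T

/-- `T ⊆ ℕ*` is a tree. -/
def IsTree (T : Set Node) : Prop := ∃ r : Node, IsTreeRooted T r

/-- `τ'` is a child of `τ` in `T`. -/
def childIn (T : Set Node) (τ τ' : Node) : Prop := τ' ∈ T ∧ ∃ n : ℕ, τ' = τ ++ [n]

/-- every node of `T` has a child in `T`. -/
def NonBlocking (T : Set Node) : Prop := ∀ τ ∈ T, ∃ n : ℕ, τ ++ [n] ∈ T

/-- every node of `T` has finitely many children in `T`. -/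
def FinBranching (T : Set Node) : Prop := ∀ τ ∈ T, {τ' : Node | childIn T τ τ'}.Finite

/-- `S` is a subtree of `T`. -/
def IsSubtree (T S : Set Node) : Prop := S ⊆ T ∧ IsTree S

/-- `P` is a path of `T`: a subtree totally ordered by the child relation
(each node has at most one child in `P`). -/
def IsPathOf (T P : Set Node) : Prop :=
  IsSubtree T P ∧ ∀ τ ∈ P, ∀ n m : ℕ, τ ++ [n] ∈ P → τ ++ [m] ∈ P → n = m

/-- `T` is a chain: a tree in which each node has at most one child. -/
def IsChainTree (T : Set Node) : Prop :=
  IsTree T ∧ ∀ τ ∈ T, ∀ n m : ℕ, τ ++ [n] ∈ T → τ ++ [m] ∈ T → n = m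

/-- `T` is dense: it contains a subtree every node of which has a descendant
in the subtree with at least two distinct children in the subtree. -/
def DenseTree (T : Set Node) : Prop :=
  ∃ S : Set Node, IsSubtree T S ∧ ∀ τ ∈ S, ∃ τ' ∈ S, τ <+: τ' ∧
    ∃ n m : ℕ, n ≠ m ∧ τ' ++ [n] ∈ S ∧ τ' ++ [m] ∈ S

/-- A Kripke tree over `AP`: a non-blocking tree together with a labelling. -/
structure KripkeTree (AP : Type) where
  T : Set Node
  root : Node
  rooted : IsTreeRooted T root
  nonblocking : NonBlocking T
  Lab : Node → Set AP

/-! ## MSOL syntax -/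

inductive MSOL (AP : Type) : Type
  | atom : AP → ℕ → MSOL AP          -- P_a(x)
  | le   : ℕ → ℕ → MSOL AP           -- x ≤ y
  | mem  : ℕ → ℕ → MSOL AP           -- x ∈ X
  | not  : MSOL AP → MSOL AP
  | and  : MSOL AP → MSOL AP → MSOL AP
  | exFO : ℕ → MSOL AP → MSOL AP     -- ∃x. φ
  | exSO : ℕ → MSOL AP → MSOL AP     -- ∃X. φ

namespace MSOL

def freeFO {AP : Type} : MSOL AP → Set ℕ
  | atom _ x => {x}
  | le x y => {x, y}
  | mem x _ => {x}
  | not φ => φ.freeFO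
  | and φ ψ => φ.freeFO ∪ ψ.freeFO
  | exFO x φ => φ.freeFO \ {x}
  | exSO _ φ => φ.freeFO

def freeSO {AP : Type} : MSOL AP → Set ℕ
  | atom _ _ => ∅
  | le _ _ => ∅
  | mem _ X => {X}
  | not φ => φ.freeSO
  | and φ ψ => φ.freeSO ∪ ψ.freeSO
  | exFO _ φ => φ.freeSO
  | exSO X φ => φ.freeSO \ {X}

/-- A sentence is a formula with no free variables. -/
def IsSentence {AP : Type} (φ : MSOL AP) : Prop := φ.freeFO = ∅ ∧ φ.freeSO = ∅

/-- The first-order fragment: no second-order variables. -/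
def IsFO {AP : Type} : MSOL AP → Prop
  | atom _ _ => True
  | le _ _ => True
  | mem _ _ => False
  | not φ => φ.IsFO
  | and φ ψ => φ.IsFO ∧ ψ.IsFO
  | exFO _ φ => φ.IsFO
  | exSO _ _ => False

end MSOL

/-! ## MSOL semantics, parametrized by the range of second-order quantifiers -/

/-- A second-order domain: for each tree, the collection of sets that
second-order quantifiers range over. -/
abbrev SODom : Type := Set Node → Set (Set Node)

def Sat {AP : Type} (D : SODom) (K : KripkeTree AP) :
    (ℕ → Node) → (ℕ → Set Node) → MSOL AP → Prop
  | V1, _,  .atom a x => V1 x ∈ K.T ∧ a ∈ K.Lab (V1 x)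
  | V1, _,  .le x y => V1 x ∈ K.T ∧ V1 y ∈ K.T ∧ V1 x <+: V1 y
  | V1, V2, .mem x X => V1 x ∈ V2 X
  | V1, V2, .not φ => ¬ Sat D K V1 V2 φ
  | V1, V2, .and φ ψ => Sat D K V1 V2 φ ∧ Sat D K V1 V2 ψ
  | V1, V2, .exFO x φ => ∃ τ ∈ K.T, Sat D K (Function.update V1 x τ) V2 φ
  | V1, V2, .exSO X φ => ∃ S ∈ D K.T, Sat D K V1 (Function.update V2 X S) φ

/-- A logic: a syntactic fragment of MSOL together with a second-order domain. -/
structure MLogic (AP : Type) where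
  syn : MSOL AP → Prop
  dom : SODom

namespace MLogic

/-- A Kripke tree satisfies a sentence. -/
def KSat {AP : Type} (L : MLogic AP) (K : KripkeTree AP) (φ : MSOL AP) : Prop :=
  ∃ V1 V2, Sat L.dom K V1 V2 φ

/-- `L ≤ L'` over the class `M`. -/
def Leq {AP : Type} (M : Set (KripkeTree AP)) (L L' : MLogic AP) : Prop :=
  ∀ φ : MSOL AP, φ.IsSentence → L.syn φ →
    ∃ φ' : MSOL AP, φ'.IsSentence ∧ L'.syn φ' ∧
      ∀ K ∈ M, (L.KSat K φ ↔ L'.KSat K φ')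

/-- `L < L'` over the class `M`. -/
def Lt {AP : Type} (M : Set (KripkeTree AP)) (L L' : MLogic AP) : Prop :=
  Leq M L L' ∧ ¬ Leq M L' L

/-- `L ≡ L'` over the class `M`. -/
def EquivExp {AP : Type} (M : Set (KripkeTree AP)) (L L' : MLogic AP) : Prop :=
  Leq M L L' ∧ Leq M L' L

/-- `L` and `L'` are expressively incomparable over the class `M`. -/
def Incomp {AP : Type} (M : Set (KripkeTree AP)) (L L' : MLogic AP) : Prop :=
  ¬ Leq M L L' ∧ ¬ Leq M L' L

end MLogic

/-! ## The concrete logics -/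

def MSOdom : SODom := fun T => {S | S ⊆ T}
def MTLdom : SODom := fun T => {S | S ⊆ T ∧ IsTree S}
def MPLdom : SODom := fun T => {S | IsPathOf T S}
def weakDom (D : SODom) : SODom := fun T => {S | S ∈ D T ∧ S.Finite}
def coweakDom (D : SODom) : SODom := fun T => {S | S ∈ D T ∧ S.Infinite}

def MSO (AP : Type) : MLogic AP := ⟨fun _ => True, MSOdom⟩
def MTL (AP : Type) : MLogic AP := ⟨fun _ => True, MTLdom⟩
def MPL (AP : Type) : MLogic AP := ⟨fun _ => True, MPLdom⟩
def WMSO (AP : Type) : MLogic AP := ⟨fun _ => True, weakDom MSOdom⟩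
def WMTL (AP : Type) : MLogic AP := ⟨fun _ => True, weakDom MTLdom⟩
def WMPL (AP : Type) : MLogic AP := ⟨fun _ => True, weakDom MPLdom⟩
def CoWMSO (AP : Type) : MLogic AP := ⟨fun _ => True, coweakDom MSOdom⟩
def CoWMTL (AP : Type) : MLogic AP := ⟨fun _ => True, coweakDom MTLdom⟩
def CoWMPL (AP : Type) : MLogic AP := ⟨fun _ => True, coweakDom MPLdom⟩
def FOL (AP : Type) : MLogic AP := ⟨MSOL.IsFO, MSOdom⟩

/-! ## Classes of Kripke trees -/

def allKT (AP : Type) : Set (KripkeTree AP) := Set.univ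
def finBrKT (AP : Type) : Set (KripkeTree AP) := {K | FinBranching K.T}
/-- Kripke trees whose underlying tree is an infinite chain
(every node has exactly one child). -/
def chainKT (AP : Type) : Set (KripkeTree AP) :=
  {K | ∀ τ ∈ K.T, ∃! τ' : Node, childIn K.T τ τ'}

theorem enat_min_add (c x y : ℕ∞) : min c (x + y) = min c (min c x + min c y) := by
  rcases le_total c x with h | h
  · rw [min_eq_left h, min_eq_left (h.trans le_self_add), min_eq_left le_self_add]
  · rcases le_total c y with h' | h'
    · rw [min_eq_left h', min_eq_left (h'.trans le_add_self), min_eq_left le_add_self]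
    · rw [min_eq_right h, min_eq_right h']

/-- pushing forward truncated counts -/
theorem push_count {α β B : Type*} [Finite B] (c : ℕ∞) (f : α → B) (g : β → B)
    (h : ∀ b, min c {i | f i = b}.encard = min c {j | g j = b}.encard) (Q : B → Prop) :
    min c {i | Q (f i)}.encard = min c {j | Q (g j)}.encard := by
  classical
  have key : ∀ s : Set B, s.Finite →
      min c {i | f i ∈ s}.encard = min c {j | g j ∈ s}.encard := by
    intro s hs
    induction s, hs using Set.Finite.induction_on with
    | empty => simp
    | @insert a s ha _ ih =>
      have e1 : {i | f i ∈ insert a s} = {i | f i = a} ∪ {i | f i ∈ s} := by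
        ext; simp
      have e2 : {i | g i ∈ insert a s} = {i | g i = a} ∪ {i | g i ∈ s} := by
        ext; simp
      rw [e1, e2, Set.encard_union_eq, Set.encard_union_eq, enat_min_add, h, ih, ← enat_min_add]
      · rw [Set.disjoint_left]; rintro x hx hx'; simp at hx hx'; subst hx; exact ha hx'
      · rw [Set.disjoint_left]; rintro x hx hx'; simp at hx hx'; subst hx; exact ha hx'
  exact key {b | Q b} (Set.toFinite _)

theorem equiv_of_enat {α β : Type*} [Finite α] (h : ENat.card α = ENat.card β) :
    Nonempty (α ≃ β) := by
  have : Finite β := by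
    rw [← ENat.card_lt_top, ← h]; exact ENat.card_lt_top_of_finite
  rw [← Finite.card_eq]
  simpa [Nat.card, ENat.card] using congrArg ENat.toNat h

theorem encard_iUnion_le_mul {α A : Type*} [Finite A] (c : ℕ) (U : A → Set α)
    (h : ∀ a, (U a).encard ≤ (c : ℕ∞)) :
    (⋃ a, U a).encard ≤ ((c * Nat.card A : ℕ) : ℕ∞) := by
  have key : ∀ s : Set A, s.Finite → (⋃ a ∈ s, U a).encard ≤ (c : ℕ∞) * s.encard := by
    intro s hs
    induction s, hs using Set.Finite.induction_on with
    | empty => simp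
    | @insert a s ha _ ih =>
      rw [Set.biUnion_insert, Set.encard_insert_of_notMem ha, mul_add, mul_one, add_comm]
      refine (Set.encard_union_le _ _).trans ?_
      exact add_le_add (h a) ih
  have := key Set.univ Set.finite_univ
  rw [Set.encard_univ] at this
  simpa [ENat.card_eq_coe_natCard] using this

theorem resp1 {α β A : Type*} [Finite A] [Nonempty A] (c : ℕ)
    (h : min ((c * Nat.card A : ℕ) : ℕ∞) (ENat.card α) = min ((c * Nat.card A : ℕ) : ℕ∞) (ENat.card β))
    (f : α → A) : ∃ g : β → A, ∀ a,
      min (c : ℕ∞) {i | f i = a}.encard = min (c : ℕ∞) {j | g j = a}.encard := by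
  classical
  rcases lt_or_ge (ENat.card α) ((c * Nat.card A : ℕ) : ℕ∞) with hlt | hge
  · have hE : ENat.card α = ENat.card β := by
      rw [min_eq_right hlt.le] at h
      rcases le_total ((c * Nat.card A : ℕ) : ℕ∞) (ENat.card β) with h2 | h2
      · rw [min_eq_left h2] at h; rw [h] at hlt; exact absurd hlt (lt_irrefl _)
      · rwa [min_eq_right h2] at h
    have fa : Finite α := by
      rw [← ENat.card_lt_top]; exact hlt.trans (ENat.natCast_lt_top _)
    have e : Nonempty (α ≃ β) := equiv_of_enat hE
    obtain ⟨e⟩ := e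
    refine ⟨f ∘ e.symm, fun a => ?_⟩
    congr 1
    have : {j | (f ∘ e.symm) j = a} = e '' {i | f i = a} := by
      ext j; simp [Equiv.image_eq_preimage_symm]
    rw [this, e.injective.encard_image]
  · have hgb : ((c * Nat.card A : ℕ) : ℕ∞) ≤ ENat.card β := by
      rw [min_eq_left hge] at h; exact min_eq_left_iff.mp h.symm
    -- a popular color
    obtain ⟨a0, ha0⟩ : ∃ a0, (c : ℕ∞) ≤ {i | f i = a0}.encard := by
      by_contra! hcon
      have hc : 1 ≤ c := by
        have := hcon (Classical.arbitrary A)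
        by_contra h0
        have : c = 0 := by omega
        subst this
        simp at hcon
      have h1 := encard_iUnion_le_mul (c - 1) (fun a => {i | f i = a}) (fun a => by
        have := hcon a
        obtain ⟨d, rfl⟩ : ∃ d, c = d + 1 := ⟨c - 1, by omega⟩
        push_cast at this
        simpa using Order.lt_add_one_iff_of_not_isMax (by simp) |>.mp this)
      have h2 : (⋃ a, {i | f i = a}) = Set.univ := by ext; simp
      rw [h2, Set.encard_univ] at h1
      have h3 := hge.trans h1
      have h4 : c * Nat.card A ≤ (c - 1) * Nat.card A := by exact_mod_cast h3
      have h5 : 0 < Nat.card A := Nat.card_pos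
      have h6 := Nat.le_of_mul_le_mul_right h4 h5
      omega
    have hU : ∀ a, ∃ U : Set α, U ⊆ {i | f i = a} ∧ U.encard = min (c : ℕ∞) {i | f i = a}.encard :=
      fun a => Set.exists_subset_encard_eq (min_le_right _ _)
    choose U hUs hUc using hU
    set U' : Set α := ⋃ a, U a with hU'
    have hU'c : U'.encard ≤ ((c * Nat.card A : ℕ) : ℕ∞) :=
      encard_iUnion_le_mul c U (fun a => by rw [hUc]; exact min_le_left _ _)
    obtain ⟨e, he⟩ : ∃ e : U' → β, Function.Injective e := by
      obtain ⟨t, -, ht⟩ := Set.exists_subset_encard_eq (s := (Set.univ : Set β))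
        (k := U'.encard) (by rw [Set.encard_univ]; exact hU'c.trans hgb)
      have : Finite U' := Set.finite_coe_iff.mpr
        (Set.encard_lt_top_iff.mp (hU'c.trans_lt (ENat.natCast_lt_top _)))
      obtain ⟨e⟩ := equiv_of_enat (α := U') (β := t) ht.symm
      exact ⟨fun u => e u, Subtype.val_injective.comp e.injective⟩
    have hmemU : ∀ (u : U'), (u : α) ∈ U (f u) := by
      rintro ⟨u, hu⟩
      obtain ⟨a, ha⟩ := Set.mem_iUnion.mp hu
      have := hUs a ha
      simp at this; subst this; exact ha
    have himg : ∀ a, (e '' {u : U' | f u = a}).encard = min (c : ℕ∞) {i | f i = a}.encard := by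
      intro a
      rw [he.encard_image, ← hUc, ← Subtype.val_injective.encard_image]
      congr 1
      ext x
      constructor
      · rintro ⟨u, hu, rfl⟩
        have := hmemU u
        rwa [show f u = a from hu] at this
      · intro hx
        exact ⟨⟨x, Set.mem_iUnion.mpr ⟨a, hx⟩⟩, hUs a hx, rfl⟩
    refine ⟨fun j => if hj : ∃ u, e u = j then f (hj.choose) else a0, fun a => ?_⟩
    have hval : ∀ u, (if hj : ∃ u', e u' = e u then f (hj.choose) else a0) = f u := by
      intro u
      have hj : ∃ u', e u' = e u := ⟨u, rfl⟩
      rw [dif_pos hj, he hj.choose_spec]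
    by_cases ha : a = a0
    · subst ha
      rw [min_eq_left ha0, eq_comm, min_eq_left]
      calc (c : ℕ∞) = (e '' {u : U' | f u = a}).encard := by rw [himg, min_eq_left ha0]
        _ ≤ _ := by
          apply Set.encard_le_encard
          rintro _ ⟨u, hu, rfl⟩
          exact (hval u).trans hu
    · have : {j | (if hj : ∃ u, e u = j then f (hj.choose) else a0) = a} = e '' {u : U' | f u = a} := by
        ext j
        constructor
        · intro hj
          by_cases hj' : ∃ u, e u = j
          · obtain ⟨u, rfl⟩ := hj'
            exact ⟨u, (hval u).symm.trans hj, rfl⟩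
          · simp only [Set.mem_ofPred_eq, dif_neg hj'] at hj
            exact absurd hj.symm ha
        · rintro ⟨u, hu, rfl⟩
          exact (hval u).trans hu
      rw [this, himg, ← min_assoc, min_self]

theorem resp {α β A B : Type*} [Finite A] [Nonempty A] (c : ℕ) (f : α → B) (g : β → B)
    (h : ∀ b, min ((c * Nat.card A : ℕ) : ℕ∞) {i | f i = b}.encard
      = min ((c * Nat.card A : ℕ) : ℕ∞) {j | g j = b}.encard)
    (f' : α → A) : ∃ g' : β → A, ∀ b a,
      min (c : ℕ∞) {i | f i = b ∧ f' i = a}.encard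
        = min (c : ℕ∞) {j | g j = b ∧ g' j = a}.encard := by
  have : ∀ b, ∃ g' : {j // g j = b} → A, ∀ a,
      min (c : ℕ∞) {i : {i // f i = b} | f' i = a}.encard
        = min (c : ℕ∞) {j | g' j = a}.encard :=
    fun b => resp1 c (h b) (fun i : {i // f i = b} => f' i)
  choose G hG using this
  refine ⟨fun j => G (g j) ⟨j, rfl⟩, fun b a => ?_⟩
  have := hG b a
  rw [← Subtype.val_injective.encard_image, ← Subtype.val_injective.encard_image] at this
  convert this using 3
  · ext i; simp [and_comm]
  · ext j
    constructor
    · rintro ⟨rfl, h2⟩; exact ⟨⟨j, rfl⟩, h2, rfl⟩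
    · rintro ⟨⟨j, rfl⟩, h2, rfl⟩; exact ⟨rfl, h2⟩

/-! ### the trees -/

def nd (i m : ℕ) : Node := i :: List.replicate m 0

theorem nd_inj {i m i' m' : ℕ} : nd i m = nd i' m' ↔ i = i' ∧ m = m' := by
  constructor
  · intro h
    simp only [nd, List.cons.injEq] at h
    refine ⟨h.1, ?_⟩
    simpa using congrArg List.length h.2
  · rintro ⟨rfl, rfl⟩; rfl

theorem nd_ne (i m : ℕ) : nd i m ≠ [] := by simp [nd]

theorem nd_succ (i m : ℕ) : nd i m ++ [0] = nd i (m+1) := by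
  simp [nd, List.replicate_succ']

theorem nd_prefix {i m i' m' : ℕ} : nd i m <+: nd i' m' ↔ i = i' ∧ m ≤ m' := by
  simp only [nd, List.cons_prefix_cons, List.prefix_replicate_iff]
  simp

theorem prefix_nd {σ : Node} {i m : ℕ} (h : σ <+: nd i m) : σ = [] ∨ ∃ k ≤ m, σ = nd i k := by
  cases σ with
  | nil => exact Or.inl rfl
  | cons a l =>
    right
    simp only [nd, List.cons_prefix_cons, List.prefix_replicate_iff] at h
    obtain ⟨rfl, h1, h2⟩ := h
    exact ⟨l.length, h1, by rw [nd, ← h2]⟩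

def TT (I : Set ℕ) : Set Node := {τ | τ = [] ∨ ∃ i ∈ I, ∃ m, τ = nd i m}

theorem nil_mem_TT (I : Set ℕ) : [] ∈ TT I := Or.inl rfl

theorem nd_mem_TT {I : Set ℕ} {i m : ℕ} : nd i m ∈ TT I ↔ i ∈ I := by
  constructor
  · rintro (h | ⟨i', hi', m', h⟩)
    · exact absurd h (nd_ne _ _)
    · rw [(nd_inj.mp h).1]; exact hi'
  · exact fun h => Or.inr ⟨i, h, m, rfl⟩

theorem singleton_eq_nd (n : ℕ) : [n] = nd n 0 := rfl

theorem append_mem_TT {I : Set ℕ} {i m n : ℕ} (h : nd i m ++ [n] ∈ TT I) : n = 0 := by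
  rcases h with h | ⟨i', -, m', h⟩
  · simp at h
  · have h1 : n ∈ (nd i m ++ [n]).tail := by simp [nd]
    rw [h] at h1
    simp [nd] at h1
    exact h1.2

def KT (AP : Type) (I : Set ℕ) (hI : I.Nonempty) : KripkeTree AP where
  T := TT I
  root := []
  rooted := by
    refine ⟨nil_mem_TT I, fun τ _ => List.nil_prefix, ?_⟩
    intro σ σ' h h'
    simp only [List.nil_append] at *
    rcases h with rfl | ⟨i, hi, m, rfl⟩
    · rw [List.prefix_nil.mp h']; exact nil_mem_TT I
    · rcases prefix_nd h' with rfl | ⟨k, -, rfl⟩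
      · exact nil_mem_TT I
      · exact nd_mem_TT.mpr hi
  nonblocking := by
    rintro τ (rfl | ⟨i, hi, m, rfl⟩)
    · obtain ⟨i, hi⟩ := hI
      exact ⟨i, nd_mem_TT (m := 0).mpr hi⟩
    · exact ⟨0, by rw [nd_succ]; exact nd_mem_TT.mpr hi⟩
  Lab := fun _ => ∅

theorem finBr_iff (I : Set ℕ) : FinBranching (TT I) ↔ I.Finite := by
  constructor
  · intro h
    have := h [] (nil_mem_TT I)
    refine (this.preimage (f := fun n => nd n 0) ?_).subset ?_
    · intro a _ b _ hab; exact (nd_inj.mp hab).1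
    · intro i hi
      exact ⟨nd_mem_TT.mpr hi, i, rfl⟩
  · rintro h τ (rfl | ⟨i, hi, m, rfl⟩)
    · refine (h.image (fun n => nd n 0)).subset ?_
      rintro _ ⟨h1, n, rfl⟩
      exact ⟨n, nd_mem_TT (m := 0).mp h1, rfl⟩
    · refine (Set.finite_singleton (nd i (m+1))).subset ?_
      rintro _ ⟨h1, n, rfl⟩
      rw [append_mem_TT h1, nd_succ]; rfl

/-! ### local structures and types -/

def pc (S : Set Node) (i : ℕ) : Set ℕ := {m | nd i m ∈ S}

abbrev Var : Type := ℕ ⊕ ℕ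

structure TpZ (W : Finset Var) where
  le : W → W → Prop
  meet : W → W → Prop
  lower : W → Prop
  conv : W → Prop
  fin : W → Prop
  sub : W → Prop

instance (W : Finset Var) : Finite (TpZ W) := by
  refine Finite.of_injective (fun t : TpZ W => (t.le, t.meet, t.lower, t.conv, t.fin, t.sub)) ?_
  rintro ⟨⟩ ⟨⟩ h
  simpa using h

def Tp (W : Finset Var) : ℕ → Type
  | 0 => TpZ W
  | r + 1 => Tp W r × (W → Set (Tp W r))

instance Tp_finite (W : Finset Var) : ∀ r, Finite (Tp W r)
  | 0 => inferInstanceAs (Finite (TpZ W))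
  | r + 1 => by
    have := Tp_finite W r
    exact inferInstanceAs (Finite (Tp W r × (W → Set (Tp W r))))

def tp (W : Finset Var) : (r : ℕ) → (Var → Set ℕ) → Tp W r
  | 0, M => (
    { le := fun u v => ∃ a ∈ M u, ∃ b ∈ M v, a ≤ b
      meet := fun u v => (M u ∩ M v).Nonempty
      lower := fun u => IsLowerSet (M u)
      conv := fun u => (M u).OrdConnected
      fin := fun u => (M u).Finite
      sub := fun u => (M u).Subsingleton } : TpZ W)
  | r + 1, M => (tp W r M, fun v => {t | ∃ X : Set ℕ, t = tp W r (Function.update M v X)})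

instance (W : Finset Var) (r : ℕ) : Nonempty (Tp W r) := ⟨tp W r (fun _ => ∅)⟩

def loc (σ : Var → Set Node) (i : ℕ) : Var → Set ℕ := fun v => pc (σ v) i

structure Eqv (W : Finset Var) (c r : ℕ) (I : Set ℕ) (σ : Var → Set Node)
    (J : Set ℕ) (ρ : Var → Set Node) : Prop where
  root : ∀ v ∈ W, ([] ∈ σ v ↔ [] ∈ ρ v)
  cnt : ∀ t, min (c : ℕ∞) {i : I | tp W r (loc σ i) = t}.encard
    = min (c : ℕ∞) {j : J | tp W r (loc ρ j) = t}.encard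

theorem Eqv.symm {W : Finset Var} {c r : ℕ} {I J : Set ℕ} {σ ρ : Var → Set Node}
    (h : Eqv W c r I σ J ρ) : Eqv W c r J ρ I σ :=
  ⟨fun v hv => (h.root v hv).symm, fun t => (h.cnt t).symm⟩

theorem Eqv.down {W : Finset Var} {c r : ℕ} {I J : Set ℕ} {σ ρ : Var → Set Node}
    (h : Eqv W c (r+1) I σ J ρ) : Eqv W c r I σ J ρ :=
  ⟨h.root, fun t => push_count (c : ℕ∞) (fun i : I => tp W (r+1) (loc σ i))
    (fun j : J => tp W (r+1) (loc ρ j)) h.cnt (fun b => b.1 = t)⟩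

theorem Eqv.zero {W : Finset Var} {c r : ℕ} {I J : Set ℕ} {σ ρ : Var → Set Node}
    (h : Eqv W c r I σ J ρ) : Eqv W c 0 I σ J ρ := by
  induction r with
  | zero => exact h
  | succ r ih => exact ih h.down

theorem loc_update (σ : Var → Set Node) (v : Var) (S : Set Node) (i : ℕ) :
    loc (Function.update σ v S) i = Function.update (loc σ i) v (pc S i) := by
  ext u
  by_cases h : u = v
  · subst h; simp [loc]
  · simp [loc, h]

theorem Eqv.step {W : Finset Var} {c r : ℕ} (hc : 1 ≤ c) {I J : Set ℕ} {σ ρ : Var → Set Node}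
    (h : Eqv W (c * Nat.card (Tp W r)) (r+1) I σ J ρ) (v : Var) (hv : v ∈ W) (S : Set Node) :
    ∃ S' ⊆ TT J, Eqv W c r I (Function.update σ v S) J (Function.update ρ v S') := by
  obtain ⟨g', hg'⟩ := resp c (fun i : I => tp W (r+1) (loc σ i))
    (fun j : J => tp W (r+1) (loc ρ j)) h.cnt
    (fun i : I => tp W r (loc (Function.update σ v S) i))
  have hX : ∀ j : J, ∃ X : Set ℕ, g' j = tp W r (Function.update (loc ρ j) v X) := by
    intro j
    have h1 := hg' (tp W (r+1) (loc ρ j)) (g' j)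
    have h2 : {i : I | tp W (r+1) (loc σ i) = tp W (r+1) (loc ρ j) ∧
        tp W r (loc (Function.update σ v S) i) = g' j}.Nonempty := by
      rw [← Set.encard_ne_zero]
      intro h0
      rw [h0] at h1
      have h3 : 1 ≤ {j' : J | tp W (r+1) (loc ρ j') = tp W (r+1) (loc ρ j) ∧
          g' j' = g' j}.encard := Set.one_le_encard_iff_nonempty.mpr ⟨j, rfl, rfl⟩
      have h4 : (1 : ℕ∞) ≤ min (c : ℕ∞) 0 := by
        rw [h1]; exact le_min (by exact_mod_cast hc) h3
      simp at h4
    obtain ⟨i, hi1, hi2⟩ := h2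
    have h5 := congrFun (congrArg Prod.snd hi1) ⟨v, hv⟩
    have h6 : g' j ∈ (tp W (r+1) (loc σ i)).2 ⟨v, hv⟩ := by
      rw [loc_update] at hi2
      exact ⟨pc S i, hi2.symm⟩
    have h7 : g' j ∈ (tp W (r+1) (loc ρ j)).2 ⟨v, hv⟩ := by
      have h8 : (tp W (r+1) (loc σ i)).2 ⟨v, hv⟩ = (tp W (r+1) (loc ρ j)).2 ⟨v, hv⟩ := h5
      rw [← h8]; exact h6
    exact h7
  choose X hX using hX
  let S' : Set Node := {τ | (τ = [] ∧ [] ∈ S) ∨ ∃ j : J, ∃ m ∈ X j, τ = nd j m}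
  have hS'0 : [] ∈ S' ↔ [] ∈ S := by
    constructor
    · rintro (h | ⟨j, m, -, h⟩)
      · exact h.2
      · exact absurd h.symm (nd_ne _ _)
    · exact fun h => Or.inl ⟨rfl, h⟩
  have hpc : ∀ j : J, pc S' j = X j := by
    intro j
    ext m
    constructor
    · rintro (h | ⟨j', m', hm', h⟩)
      · exact absurd h.1 (nd_ne _ _)
      · obtain ⟨h1, rfl⟩ := nd_inj.mp h
        rw [Subtype.ext h1]; exact hm'
    · intro hm
      exact Or.inr ⟨j, m, hm, rfl⟩
  refine ⟨S', ?_, ?_, ?_⟩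
  · rintro τ (⟨rfl, -⟩ | ⟨j, m, -, rfl⟩)
    · exact nil_mem_TT J
    · exact nd_mem_TT.mpr j.2
  · intro u hu
    by_cases huv : u = v
    · subst huv; simp [hS'0]
    · simp [huv, h.root u hu]
  · intro t
    have h1 := push_count (c : ℕ∞)
      (fun i : I => (tp W (r+1) (loc σ i), tp W r (loc (Function.update σ v S) i)))
      (fun j : J => (tp W (r+1) (loc ρ j), g' j))
      (fun b => by simpa only [Prod.ext_iff] using hg' b.1 b.2) (fun b => b.2 = t)
    have h2 : ∀ j : J, tp W r (loc (Function.update ρ v S') j) = g' j := by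
      intro j; rw [loc_update, hpc, hX]
    simpa only [h2] using h1

/-! ### transfer of base information -/

theorem Eqv.ex {W : Finset Var} {c r : ℕ} (hc : 2 ≤ c) {I J : Set ℕ} {σ ρ : Var → Set Node}
    (h : Eqv W c r I σ J ρ) (Q : TpZ W → Prop) :
    (∃ i ∈ I, Q (tp W 0 (loc σ i))) ↔ (∃ j ∈ J, Q (tp W 0 (loc ρ j))) := by
  have h0 := push_count (c : ℕ∞) (fun i : I => tp W 0 (loc σ i))
    (fun j : J => tp W 0 (loc ρ j)) h.zero.cnt Q
  have hc1 : (c : ℕ∞) ≠ 0 := by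
    have : c ≠ 0 := by omega
    exact_mod_cast this
  have key : ({i : I | Q (tp W 0 (loc σ i))}.encard = 0) ↔
      ({j : J | Q (tp W 0 (loc ρ j))}.encard = 0) := by
    have e1 : ∀ x : ℕ∞, x = 0 ↔ min (c : ℕ∞) x = 0 := by
      intro x
      rcases min_choice (c : ℕ∞) x with h | h
      · rw [h]
        constructor
        · rintro rfl; simpa using h.symm
        · intro h; exact absurd h hc1
      · rw [h]
    rw [e1, h0, ← e1]
  have := not_congr key
  rw [← ne_eq, ← ne_eq, Set.encard_ne_zero, Set.encard_ne_zero] at this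
  constructor
  · rintro ⟨i, hi, hq⟩
    obtain ⟨j, hj⟩ := this.mp ⟨⟨i, hi⟩, hq⟩
    exact ⟨j, j.2, hj⟩
  · rintro ⟨i, hi, hq⟩
    obtain ⟨j, hj⟩ := this.mpr ⟨⟨i, hi⟩, hq⟩
    exact ⟨j, j.2, hj⟩

theorem Eqv.all {W : Finset Var} {c r : ℕ} (hc : 2 ≤ c) {I J : Set ℕ} {σ ρ : Var → Set Node}
    (h : Eqv W c r I σ J ρ) (Q : TpZ W → Prop) :
    (∀ i ∈ I, Q (tp W 0 (loc σ i))) ↔ (∀ j ∈ J, Q (tp W 0 (loc ρ j))) := by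
  have := not_congr (h.ex hc (fun t => ¬ Q t))
  push Not at this
  exact this

theorem Eqv.uniq {W : Finset Var} {c r : ℕ} (hc : 2 ≤ c) {I J : Set ℕ} {σ ρ : Var → Set Node}
    (h : Eqv W c r I σ J ρ) (Q : TpZ W → Prop) :
    (∀ i ∈ I, ∀ i' ∈ I, Q (tp W 0 (loc σ i)) → Q (tp W 0 (loc σ i')) → i = i') ↔
    (∀ i ∈ J, ∀ i' ∈ J, Q (tp W 0 (loc ρ i)) → Q (tp W 0 (loc ρ i')) → i = i') := by
  have h0 := push_count (c : ℕ∞) (fun i : I => tp W 0 (loc σ i))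
    (fun j : J => tp W 0 (loc ρ j)) h.zero.cnt Q
  have hc1 : ¬ (c : ℕ∞) ≤ 1 := by
    have : ¬ c ≤ 1 := by omega
    exact_mod_cast this
  have key : ({i : I | Q (tp W 0 (loc σ i))}.encard ≤ 1) ↔
      ({j : J | Q (tp W 0 (loc ρ j))}.encard ≤ 1) := by
    have e1 : ∀ x : ℕ∞, x ≤ 1 ↔ min (c : ℕ∞) x ≤ 1 := by
      intro x; rw [min_le_iff]; simp [hc1]
    rw [e1, h0, ← e1]
  rw [Set.encard_le_one_iff, Set.encard_le_one_iff] at key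
  constructor
  · intro h1 i hi i' hi' hq hq'
    have := key.mp (fun a b ha hb => Subtype.ext (h1 a a.2 b b.2 ha hb)) ⟨i, hi⟩ ⟨i', hi'⟩ hq hq'
    exact congrArg Subtype.val this
  · intro h1 i hi i' hi' hq hq'
    have := key.mpr (fun a b ha hb => Subtype.ext (h1 a a.2 b b.2 ha hb)) ⟨i, hi⟩ ⟨i', hi'⟩ hq hq'
    exact congrArg Subtype.val this

/-! ### characterisation of the domains -/

def Uq (I : Set ℕ) (S : Set Node) : Prop :=
  ∀ i ∈ I, ∀ i' ∈ I, (pc S i).Nonempty → (pc S i').Nonempty → i = i'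

def Ex (I : Set ℕ) (S : Set Node) : Prop := ∃ i ∈ I, (pc S i).Nonempty

theorem single_iff {I : Set ℕ} {S : Set Node} (hS : S ⊆ TT I) :
    (∃ τ ∈ TT I, S = {τ}) ↔
      (([] ∈ S ∧ ¬ Ex I S) ∨ ([] ∉ S ∧ Ex I S ∧ Uq I S ∧ ∀ i ∈ I, (pc S i).Subsingleton)) := by
  constructor
  · rintro ⟨τ, (rfl | ⟨i, hi, m, rfl⟩), rfl⟩
    · left
      refine ⟨rfl, ?_⟩
      rintro ⟨i, -, m, h⟩
      exact nd_ne _ _ h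
    · right
      refine ⟨fun h => nd_ne _ _ h.symm, ⟨i, hi, m, rfl⟩, ?_, ?_⟩
      · rintro a - b - ⟨m1, h1⟩ ⟨m2, h2⟩
        rw [(nd_inj.mp h1).1, (nd_inj.mp h2).1]
      · rintro a - m1 h1 m2 h2
        rw [(nd_inj.mp h1).2, (nd_inj.mp h2).2]
  · rintro (⟨h0, h1⟩ | ⟨h0, ⟨i, hi, m, hm⟩, h2, h3⟩)
    · refine ⟨[], nil_mem_TT I, Set.eq_singleton_iff_unique_mem.mpr ⟨h0, fun τ hτ => ?_⟩⟩
      rcases hS hτ with rfl | ⟨i, hi, m, rfl⟩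
      · rfl
      · exact absurd ⟨i, hi, m, hτ⟩ h1
    · refine ⟨nd i m, nd_mem_TT.mpr hi, Set.eq_singleton_iff_unique_mem.mpr ⟨hm, fun τ hτ => ?_⟩⟩
      rcases hS hτ with rfl | ⟨i', hi', m', rfl⟩
      · exact absurd hτ h0
      · have := h2 i hi i' hi' ⟨m, hm⟩ ⟨m', hτ⟩
        subst this
        rw [h3 i hi hm hτ]

theorem tree_iff {I : Set ℕ} {S : Set Node} (hS : S ⊆ TT I) :
    IsTree S ↔
      (([] ∈ S ∧ ∀ i ∈ I, IsLowerSet (pc S i)) ∨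
       ([] ∉ S ∧ Ex I S ∧ Uq I S ∧ ∀ i ∈ I, (pc S i).OrdConnected)) := by
  constructor
  · rintro ⟨ρ, hr, hp, hcl⟩
    have hcl' : ∀ τ ∈ S, ∀ τ', ρ <+: τ' → τ' <+: τ → τ' ∈ S := by
      rintro τ hτ τ' ⟨s, rfl⟩ ⟨s', rfl⟩
      exact hcl (s ++ s') s (by simpa using hτ) (List.prefix_append _ _)
    rcases hS hr with rfl | ⟨i, hi, m, rfl⟩
    · left
      refine ⟨hr, fun i _ a b hba ha => ?_⟩
      exact hcl' _ ha _ List.nil_prefix (nd_prefix.mpr ⟨rfl, hba⟩)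
    · right
      refine ⟨fun h => nd_ne i m (List.prefix_nil.mp (hp _ h)), ⟨i, hi, m, hr⟩, ?_, ?_⟩
      · rintro a - b - ⟨m1, h1⟩ ⟨m2, h2⟩
        rw [← (nd_prefix.mp (hp _ h1)).1, ← (nd_prefix.mp (hp _ h2)).1]
      · rintro a -
        refine ⟨fun x hx y hy z hz => ?_⟩
        have h1 := nd_prefix.mp (hp _ hx)
        exact hcl' _ hy _ (nd_prefix.mpr ⟨h1.1, h1.2.trans hz.1⟩) (nd_prefix.mpr ⟨rfl, hz.2⟩)
  · rintro (⟨h0, h1⟩ | ⟨h0, ⟨i, hi, hne⟩, h2, h3⟩)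
    · refine ⟨[], h0, fun _ _ => List.nil_prefix, fun s s' hs hs' => ?_⟩
      simp only [List.nil_append] at *
      rcases hS hs with rfl | ⟨i, hi, m, rfl⟩
      · rw [List.prefix_nil.mp hs']; exact h0
      · rcases prefix_nd hs' with rfl | ⟨k, hk, rfl⟩
        · exact h0
        · exact h1 i hi hk hs
    · classical
      have hm : Nat.find hne ∈ pc S i := Nat.find_spec hne
      have hall : ∀ τ ∈ S, ∃ m, Nat.find hne ≤ m ∧ τ = nd i m := by
        intro τ hτ
        rcases hS hτ with rfl | ⟨i', hi', m', rfl⟩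
        · exact absurd hτ h0
        · have := h2 i hi i' hi' hne ⟨m', hτ⟩
          subst this
          exact ⟨m', Nat.find_min' hne hτ, rfl⟩
      refine ⟨nd i (Nat.find hne), hm, ?_, ?_⟩
      · intro τ hτ
        obtain ⟨m, h, rfl⟩ := hall τ hτ
        exact nd_prefix.mpr ⟨rfl, h⟩
      · intro s s' hs hs'
        obtain ⟨m, h, he⟩ := hall _ hs
        have hpre : nd i (Nat.find hne) ++ s' <+: nd i m := by
          rw [← he]; exact (List.prefix_append_right_inj _).mpr hs'
        rcases prefix_nd hpre with h' | ⟨k, hk, h'⟩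
        · exact absurd (List.append_eq_nil_iff.mp h').1 (nd_ne _ _)
        · rw [h']
          have h5 : nd i (Nat.find hne) <+: nd i k := by rw [← h']; exact List.prefix_append _ _
          rw [he] at hs
          exact (h3 i hi).out hm hs ⟨(nd_prefix.mp h5).2, hk⟩

theorem path_iff {I : Set ℕ} {S : Set Node} (hS : S ⊆ TT I) :
    IsPathOf (TT I) S ↔ IsTree S ∧ Uq I S := by
  constructor
  · rintro ⟨⟨-, hT⟩, h⟩
    refine ⟨hT, ?_⟩
    rcases (tree_iff hS).mp hT with ⟨h0, h1⟩ | ⟨-, -, h2, -⟩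
    · rintro i hi i' hi' ⟨m, hm⟩ ⟨m', hm'⟩
      exact h [] h0 i i' (h1 i hi (Nat.zero_le m) hm) (h1 i' hi' (Nat.zero_le m') hm')
    · exact h2
  · rintro ⟨hT, hU⟩
    refine ⟨⟨hS, hT⟩, fun τ hτ n m hn hm => ?_⟩
    rcases hS hτ with rfl | ⟨i, hi, k, rfl⟩
    · have e1 : nd n 0 ∈ S := hn
      have e2 : nd m 0 ∈ S := hm
      exact hU n (nd_mem_TT.mp (hS e1)) m (nd_mem_TT.mp (hS e2)) ⟨0, e1⟩ ⟨0, e2⟩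
    · rw [append_mem_TT (hS hn), append_mem_TT (hS hm)]

theorem fin_iff {I : Set ℕ} {S : Set Node} (hS : S ⊆ TT I) (hU : Uq I S) :
    S.Finite ↔ ∀ i ∈ I, (pc S i).Finite := by
  constructor
  · intro h i _
    exact h.preimage (f := fun m => nd i m) (fun a _ b _ hab => (nd_inj.mp hab).2)
  · intro h
    by_cases hE : Ex I S
    · obtain ⟨i, hi, hne⟩ := hE
      refine (((h i hi).image (nd i)).insert []).subset ?_
      intro τ hτ
      rcases hS hτ with rfl | ⟨i', hi', m', rfl⟩
      · exact Or.inl rfl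
      · have := hU i hi i' hi' hne ⟨m', hτ⟩
        subst this
        exact Or.inr ⟨m', hτ, rfl⟩
    · refine (Set.finite_singleton []).subset ?_
      intro τ hτ
      rcases hS hτ with rfl | ⟨i', hi', m', rfl⟩
      · rfl
      · exact absurd ⟨i', hi', m', hτ⟩ hE

/-! ### invariance -/

section inv
variable {W : Finset Var} {c r : ℕ} (hc : 2 ≤ c) {I J : Set ℕ} {σ ρ : Var → Set Node}
    (h : Eqv W c r I σ J ρ) {v : Var} (hv : v ∈ W)

theorem inv_Ex (hc : 2 ≤ c) (h : Eqv W c r I σ J ρ) (hv : v ∈ W) :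
    Ex I (σ v) ↔ Ex J (ρ v) := by
  simpa [tp, Ex, loc] using h.ex hc (fun t => t.meet ⟨v, hv⟩ ⟨v, hv⟩)

theorem inv_Uq (hc : 2 ≤ c) (h : Eqv W c r I σ J ρ) (hv : v ∈ W) :
    Uq I (σ v) ↔ Uq J (ρ v) := by
  simpa only [tp, Uq, loc, Set.inter_self] using h.uniq hc (fun t => t.meet ⟨v, hv⟩ ⟨v, hv⟩)

theorem inv_single (hc : 2 ≤ c) (h : Eqv W c r I σ J ρ) (hv : v ∈ W)
    (hS : σ v ⊆ TT I) (hS' : ρ v ⊆ TT J) :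
    (∃ τ ∈ TT I, σ v = {τ}) ↔ (∃ τ ∈ TT J, ρ v = {τ}) := by
  rw [single_iff hS, single_iff hS', h.root v hv, inv_Ex hc h hv, inv_Uq hc h hv]
  have := h.all hc (fun t => t.sub ⟨v, hv⟩)
  simp only [tp, loc] at this
  rw [this]

theorem inv_tree (hc : 2 ≤ c) (h : Eqv W c r I σ J ρ) (hv : v ∈ W)
    (hS : σ v ⊆ TT I) (hS' : ρ v ⊆ TT J) : IsTree (σ v) ↔ IsTree (ρ v) := by
  rw [tree_iff hS, tree_iff hS', h.root v hv, inv_Ex hc h hv, inv_Uq hc h hv]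
  have h1 := h.all hc (fun t => t.lower ⟨v, hv⟩)
  have h2 := h.all hc (fun t => t.conv ⟨v, hv⟩)
  simp only [tp, loc] at h1 h2
  rw [h1, h2]

theorem inv_path (hc : 2 ≤ c) (h : Eqv W c r I σ J ρ) (hv : v ∈ W)
    (hS : σ v ⊆ TT I) (hS' : ρ v ⊆ TT J) :
    IsPathOf (TT I) (σ v) ↔ IsPathOf (TT J) (ρ v) := by
  rw [path_iff hS, path_iff hS', inv_tree hc h hv hS hS', inv_Uq hc h hv]

theorem inv_wpath (hc : 2 ≤ c) (h : Eqv W c r I σ J ρ) (hv : v ∈ W)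
    (hS : σ v ⊆ TT I) (hS' : ρ v ⊆ TT J) :
    (IsPathOf (TT I) (σ v) ∧ (σ v).Finite) ↔ (IsPathOf (TT J) (ρ v) ∧ (ρ v).Finite) := by
  rw [inv_path hc h hv hS hS']
  refine and_congr_right fun hp => ?_
  have hU' := ((path_iff hS').mp hp).2
  rw [fin_iff hS ((inv_Uq hc h hv).mpr hU'), fin_iff hS' hU']
  have := h.all hc (fun t => t.fin ⟨v, hv⟩)
  simpa only [tp, loc] using this

end inv

def InvDom (D : SODom) : Prop :=
  (∀ T, ∀ S ∈ D T, S ⊆ T) ∧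
  ∀ (W : Finset Var) (c r : ℕ) (I J : Set ℕ) (σ ρ : Var → Set Node) (v : Var),
    2 ≤ c → Eqv W c r I σ J ρ → v ∈ W → σ v ⊆ TT I → ρ v ⊆ TT J →
    σ v ∈ D (TT I) → ρ v ∈ D (TT J)

theorem inv_MSO : InvDom MSOdom := ⟨fun _ _ h => h, fun _ _ _ _ _ _ _ _ _ _ _ _ h _ => h⟩
theorem inv_MTL : InvDom MTLdom := ⟨fun _ _ h => h.1,
  fun _ _ _ _ _ _ _ _ hc h hv hS hS' h' => ⟨hS', (inv_tree hc h hv hS hS').mp h'.2⟩⟩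
theorem inv_MPL : InvDom MPLdom := ⟨fun _ _ h => h.1.1,
  fun _ _ _ _ _ _ _ _ hc h hv hS hS' h' => (inv_path hc h hv hS hS').mp h'⟩
theorem inv_WMPL : InvDom (weakDom MPLdom) := ⟨fun _ _ h => h.1.1.1,
  fun _ _ _ _ _ _ _ _ hc h hv hS hS' h' => (inv_wpath hc h hv hS hS').mp h'⟩

/-! ### the main back-and-forth argument -/

def dep {AP : Type} : MSOL AP → ℕ
  | .atom _ _ => 0
  | .le _ _ => 0
  | .mem _ _ => 0
  | .not φ => dep φ
  | .and φ ψ => max (dep φ) (dep ψ)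
  | .exFO _ φ => dep φ + 1
  | .exSO _ φ => dep φ + 1

def vrs {AP : Type} : MSOL AP → Finset Var
  | .atom _ x => {Sum.inl x}
  | .le x y => {Sum.inl x, Sum.inl y}
  | .mem x X => {Sum.inl x, Sum.inr X}
  | .not φ => vrs φ
  | .and φ ψ => vrs φ ∪ vrs ψ
  | .exFO x φ => insert (Sum.inl x) (vrs φ)
  | .exSO X φ => insert (Sum.inr X) (vrs φ)

noncomputable def thr (W : Finset Var) : ℕ → ℕ
  | 0 => 2
  | r + 1 => thr W r * Nat.card (Tp W r)

theorem thr_ge (W : Finset Var) (r : ℕ) : 2 ≤ thr W r := by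
  induction r with
  | zero => exact le_rfl
  | succ r ih =>
    have : 0 < Nat.card (Tp W r) := Nat.card_pos
    exact ih.trans (Nat.le_mul_of_pos_right _ this)

def val (V1 : ℕ → Node) (V2 : ℕ → Set Node) : Var → Set Node :=
  Sum.elim (fun x => {V1 x}) V2

theorem val_inl (V1 : ℕ → Node) (V2 : ℕ → Set Node) (x : ℕ) (τ : Node) :
    val (Function.update V1 x τ) V2 = Function.update (val V1 V2) (Sum.inl x) {τ} := by
  ext v
  rcases v with y | Y
  · by_cases h : y = x
    · subst h; simp [val]
    · simp [val, h]
  · simp [val]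

theorem val_inr (V1 : ℕ → Node) (V2 : ℕ → Set Node) (X : ℕ) (S : Set Node) :
    val V1 (Function.update V2 X S) = Function.update (val V1 V2) (Sum.inr X) S := by
  ext v
  rcases v with y | Y
  · simp [val]
  · by_cases h : Y = X
    · subst h; simp [val]
    · simp [val, h]

theorem le_iff {I : Set ℕ} {a b : Node} (ha : a ∈ TT I) (hb : b ∈ TT I) :
    a <+: b ↔ ([] ∈ ({a} : Set Node) ∨
      ∃ i ∈ I, ∃ m ∈ pc {a} i, ∃ n ∈ pc {b} i, m ≤ n) := by
  constructor
  · intro h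
    rcases ha with rfl | ⟨i, hi, m, rfl⟩
    · exact Or.inl rfl
    · right
      rcases hb with rfl | ⟨j, hj, n, rfl⟩
      · exact absurd (List.prefix_nil.mp h) (nd_ne _ _)
      · obtain ⟨rfl, h2⟩ := nd_prefix.mp h
        exact ⟨i, hi, m, rfl, n, rfl, h2⟩
  · rintro (h | ⟨i, hi, m, h1, n, h2, h3⟩)
    · rw [← show [] = a from h]; exact List.nil_prefix
    · rw [← show nd i m = a from h1, ← show nd i n = b from h2]
      exact nd_prefix.mpr ⟨rfl, h3⟩

theorem mem_iff' {I : Set ℕ} {a : Node} {S : Set Node} (ha : a ∈ TT I) :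
    a ∈ S ↔ (([] ∈ ({a} : Set Node) ∧ [] ∈ S) ∨
      ∃ i ∈ I, (pc {a} i ∩ pc S i).Nonempty) := by
  constructor
  · intro h
    rcases ha with rfl | ⟨i, hi, m, rfl⟩
    · exact Or.inl ⟨rfl, h⟩
    · exact Or.inr ⟨i, hi, m, rfl, h⟩
  · rintro (⟨h, h'⟩ | ⟨i, hi, m, h1, h2⟩)
    · rw [← show [] = a from h]; exact h'
    · rw [← show nd i m = a from h1]; exact h2

theorem main_game {AP : Type} (D : SODom) (hD : InvDom D) (W : Finset Var) (φ : MSOL AP) :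
    ∀ (r : ℕ) (I J : Set ℕ) (hI : I.Nonempty) (hJ : J.Nonempty) (V1 V1' : ℕ → Node)
      (V2 V2' : ℕ → Set Node),
      vrs φ ⊆ W → dep φ ≤ r → (∀ x, V1 x ∈ TT I) → (∀ x, V1' x ∈ TT J) →
      Eqv W (thr W r) r I (val V1 V2) J (val V1' V2') →
      Sat D (KT AP I hI) V1 V2 φ → Sat D (KT AP J hJ) V1' V2' φ := by
  induction φ with
  | atom a x =>
    intro r I J hI hJ V1 V1' V2 V2' hW hr h1 h1' hE hs
    exact absurd hs.2 (by simp [KT])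
  | le x y =>
    intro r I J hI hJ V1 V1' V2 V2' hW hr h1 h1' hE hs
    have hx : Sum.inl x ∈ W := hW (by simp [vrs])
    have hy : Sum.inl y ∈ W := hW (by simp [vrs])
    refine ⟨h1' x, h1' y, ?_⟩
    have h3 := (le_iff (h1 x) (h1 y)).mp hs.2.2
    refine (le_iff (h1' x) (h1' y)).mpr (h3.imp (hE.root _ hx).mp ?_)
    exact (hE.ex (thr_ge W r) (fun t => t.le ⟨_, hx⟩ ⟨_, hy⟩)).mp
  | mem x X =>
    intro r I J hI hJ V1 V1' V2 V2' hW hr h1 h1' hE hs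
    have hx : Sum.inl x ∈ W := hW (by simp [vrs])
    have hX : Sum.inr X ∈ W := hW (by simp [vrs])
    have h3 := (mem_iff' (h1 x)).mp (show V1 x ∈ V2 X from hs)
    refine (mem_iff' (S := V2' X) (h1' x)).mpr
      (h3.imp (And.imp (hE.root _ hx).mp (hE.root _ hX).mp) ?_)
    exact (hE.ex (thr_ge W r) (fun t => t.meet ⟨_, hx⟩ ⟨_, hX⟩)).mp
  | not φ ih =>
    intro r I J hI hJ V1 V1' V2 V2' hW hr h1 h1' hE hs hs'
    exact hs (ih r J I hJ hI V1' V1 V2' V2 hW hr h1' h1 hE.symm hs')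
  | and φ ψ ih1 ih2 =>
    intro r I J hI hJ V1 V1' V2 V2' hW hr h1 h1' hE hs
    have hW' := Finset.union_subset_iff.mp hW
    have hr' := max_le_iff.mp hr
    exact ⟨ih1 r I J hI hJ V1 V1' V2 V2' hW'.1 hr'.1 h1 h1' hE hs.1,
      ih2 r I J hI hJ V1 V1' V2 V2' hW'.2 hr'.2 h1 h1' hE hs.2⟩
  | exFO x φ ih =>
    intro r I J hI hJ V1 V1' V2 V2' hW hr h1 h1' hE hs
    have hW' := Finset.insert_subset_iff.mp hW
    obtain ⟨τ, hτ, hs⟩ := hs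
    change τ ∈ TT I at hτ
    obtain _ | r := r
    · simp [dep] at hr
    have hr' : dep φ ≤ r := by simpa [dep] using hr
    have hge := thr_ge W r
    obtain ⟨S', hS', hE'⟩ := Eqv.step (by omega) hE (Sum.inl x) hW'.1 {τ}
    have h4 := (inv_single (v := Sum.inl x) hge hE' hW'.1
      (by simpa using hτ) (by simpa using hS')).mp ⟨τ, hτ, by simp⟩
    obtain ⟨τ', hτ', h5⟩ := h4
    simp only [Function.update_self] at h5
    subst h5
    rw [← val_inl, ← val_inl] at hE'
    refine ⟨τ', hτ', ih r I J hI hJ _ _ V2 V2' hW'.2 hr' ?_ ?_ hE' hs⟩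
    · intro y
      by_cases hy : y = x
      · subst hy; simpa using hτ
      · simpa [hy] using h1 y
    · intro y
      by_cases hy : y = x
      · subst hy; simpa using hτ'
      · simpa [hy] using h1' y
  | exSO X φ ih =>
    intro r I J hI hJ V1 V1' V2 V2' hW hr h1 h1' hE hs
    have hW' := Finset.insert_subset_iff.mp hW
    obtain ⟨S, hS, hs⟩ := hs
    change S ∈ D (TT I) at hS
    obtain _ | r := r
    · simp [dep] at hr
    have hr' : dep φ ≤ r := by simpa [dep] using hr
    have hge := thr_ge W r
    obtain ⟨S', hS', hE'⟩ := Eqv.step (by omega) hE (Sum.inr X) hW'.1 S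
    have h4 := hD.2 W _ r I J _ _ (Sum.inr X) hge hE' hW'.1
      (by simpa using hD.1 _ _ hS) (by simpa using hS') (by simpa using hS)
    simp only [Function.update_self] at h4
    rw [← val_inr, ← val_inr] at hE'
    exact ⟨S', h4, ih r I J hI hJ V1 V1' _ _ hW'.2 hr' h1 h1' hE' hs⟩

theorem sat_congr {AP : Type} (D : SODom) (K : KripkeTree AP) (φ : MSOL AP) :
    ∀ (V1 V1' : ℕ → Node) (V2 V2' : ℕ → Set Node),
      (∀ x ∈ φ.freeFO, V1 x = V1' x) → (∀ X ∈ φ.freeSO, V2 X = V2' X) →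
      (Sat D K V1 V2 φ ↔ Sat D K V1' V2' φ) := by
  induction φ with
  | atom a x =>
    intro V1 V1' V2 V2' h1 h2
    simp only [Sat, h1 x (by simp [MSOL.freeFO])]
  | le x y =>
    intro V1 V1' V2 V2' h1 h2
    simp only [Sat, h1 x (by simp [MSOL.freeFO]), h1 y (by simp [MSOL.freeFO])]
  | mem x X =>
    intro V1 V1' V2 V2' h1 h2
    simp only [Sat, h1 x (by simp [MSOL.freeFO]), h2 X (by simp [MSOL.freeSO])]
  | not φ ih =>
    intro V1 V1' V2 V2' h1 h2
    exact not_congr (ih _ _ _ _ h1 h2)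
  | and φ ψ ih1 ih2 =>
    intro V1 V1' V2 V2' h1 h2
    exact and_congr
      (ih1 _ _ _ _ (fun x hx => h1 x (Or.inl hx)) (fun x hx => h2 x (Or.inl hx)))
      (ih2 _ _ _ _ (fun x hx => h1 x (Or.inr hx)) (fun x hx => h2 x (Or.inr hx)))
  | exFO x φ ih =>
    intro V1 V1' V2 V2' h1 h2
    refine exists_congr fun τ => and_congr_right fun _ => ih _ _ _ _ ?_ h2
    intro y hy
    by_cases hyx : y = x
    · subst hyx; simp
    · simpa [hyx] using h1 y ⟨hy, hyx⟩
  | exSO X φ ih =>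
    intro V1 V1' V2 V2' h1 h2
    refine exists_congr fun τ => and_congr_right fun _ => ih _ _ _ _ h1 ?_
    intro y hy
    by_cases hyx : y = X
    · subst hyx; simp
    · simpa [hyx] using h2 y ⟨hy, hyx⟩

theorem main_undef (AP : Type) (L : MLogic AP) (hD : InvDom L.dom) :
    ¬ ∃ φ : MSOL AP, φ.IsSentence ∧
      ∀ K : KripkeTree AP, (L.KSat K φ ↔ ¬ FinBranching K.T) := by
  rintro ⟨φ, ⟨hf1, hf2⟩, h⟩
  let W := vrs φ
  let r := dep φ
  let n := thr W r
  have hn : 2 ≤ n := thr_ge W r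
  let J : Set ℕ := Set.Iio n
  have hJ : J.Nonempty := ⟨0, by show 0 < n; omega⟩
  have hI : (Set.univ : Set ℕ).Nonempty := ⟨0, trivial⟩
  obtain ⟨V1, V2, hs⟩ := (h (KT AP Set.univ hI)).mpr (by
    show ¬ FinBranching (TT Set.univ)
    rw [finBr_iff]; exact Set.infinite_univ)
  rw [sat_congr L.dom _ φ V1 (fun _ => []) V2 (fun _ => ∅) (by simp [hf1]) (by simp [hf2])] at hs
  have hs' : Sat L.dom (KT AP J hJ) (fun _ => []) (fun _ => ∅) φ := by
    refine main_game L.dom hD W φ r Set.univ J hI hJ _ _ _ _ (Finset.Subset.refl _) le_rfl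
      (fun _ => nil_mem_TT _) (fun _ => nil_mem_TT _) ⟨fun _ _ => Iff.rfl, fun t => ?_⟩ hs
    have hl : ∀ i, loc (val (fun _ => []) (fun _ => ∅)) i = fun _ => ∅ := by
      intro i
      ext v m
      rcases v with x | X
      · simp [loc, val, pc, nd_ne]
      · simp [loc, val, pc]
    simp only [hl]
    by_cases ht : tp W r (fun _ => ∅) = t
    · have e1 : {i : (Set.univ : Set ℕ) | tp W r (fun _ => ∅) = t} = Set.univ := by
        ext; simp [ht]
      have e2 : {j : J | tp W r (fun _ => ∅) = t} = Set.univ := by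
        ext; simp [ht]
      rw [e1, e2, Set.encard_univ, Set.encard_univ, ENat.card_coe_set_eq, ENat.card_coe_set_eq,
        Set.encard_eq_top Set.infinite_univ]
      have e3 : J.encard = n := by
        have : J = ((Finset.range n : Finset ℕ) : Set ℕ) := by ext; simp [J]
        rw [this, Set.encard_coe_eq_coe_finsetCard, Finset.card_range]
      rw [e3]
      simp [n]
    · simp [ht]
  have := (h (KT AP J hJ)).mp ⟨_, _, hs'⟩
  exact this ((finBr_iff J).mpr (Set.finite_Iio n))

/-- the infinitely-branching property is not definable in
MSO, MTL, MPL, or WMPL. -/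
theorem stmt6 (AP : Type) [Fintype AP] :
    (¬ ∃ φ : MSOL AP, φ.IsSentence ∧
      ∀ K : KripkeTree AP, ((MSO AP).KSat K φ ↔ ¬ FinBranching K.T)) ∧
    (¬ ∃ φ : MSOL AP, φ.IsSentence ∧
      ∀ K : KripkeTree AP, ((MTL AP).KSat K φ ↔ ¬ FinBranching K.T)) ∧
    (¬ ∃ φ : MSOL AP, φ.IsSentence ∧
      ∀ K : KripkeTree AP, ((MPL AP).KSat K φ ↔ ¬ FinBranching K.T)) ∧
    (¬ ∃ φ : MSOL AP, φ.IsSentence ∧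
      ∀ K : KripkeTree AP, ((WMPL AP).KSat K φ ↔ ¬ FinBranching K.T)) := by
  exact ⟨main_undef AP _ inv_MSO, main_undef AP _ inv_MTL, main_undef AP _ inv_MPL,
    main_undef AP _ inv_WMPL⟩
end

section
/- Over the class of finitely-branching Kripke trees, WMPL is strictly less expressive than WMTL, and WMTL is strictly less expressive than WMSO: WMPL < WMTL < WMSO. -/
namespace Aux8

/-! ### Generic facts -/

theorem sat_congr {AP : Type} (D : SODom) (K : KripkeTree AP) (φ : MSOL AP) :
    ∀ (V1 W1 : ℕ → Node) (V2 W2 : ℕ → Set Node),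
      (∀ x ∈ φ.freeFO, V1 x = W1 x) → (∀ X ∈ φ.freeSO, V2 X = W2 X) →
      (Sat D K V1 V2 φ ↔ Sat D K W1 W2 φ) := by
  induction φ with
  | atom a x => intro V1 W1 V2 W2 h1 h2; simp [Sat, h1 x (by simp [MSOL.freeFO])]
  | le x y =>
    intro V1 W1 V2 W2 h1 h2
    simp [Sat, h1 x (by simp [MSOL.freeFO]), h1 y (by simp [MSOL.freeFO])]
  | mem x X =>
    intro V1 W1 V2 W2 h1 h2
    simp [Sat, h1 x (by simp [MSOL.freeFO]), h2 X (by simp [MSOL.freeSO])]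
  | not φ ih =>
    intro V1 W1 V2 W2 h1 h2
    simp only [Sat]
    rw [ih V1 W1 V2 W2 h1 h2]
  | and φ ψ ih1 ih2 =>
    intro V1 W1 V2 W2 h1 h2
    simp only [Sat]
    rw [ih1 V1 W1 V2 W2 (fun x hx => h1 x (Or.inl hx)) (fun x hx => h2 x (Or.inl hx)),
      ih2 V1 W1 V2 W2 (fun x hx => h1 x (Or.inr hx)) (fun x hx => h2 x (Or.inr hx))]
  | exFO x φ ih =>
    intro V1 W1 V2 W2 h1 h2
    simp only [Sat]
    refine exists_congr fun τ => and_congr_right fun _ => ih _ _ _ _ ?_ h2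
    intro y hy
    by_cases hxy : y = x
    · subst hxy; simp
    · simp [Function.update_of_ne hxy, h1 y ⟨hy, hxy⟩]
  | exSO x φ ih =>
    intro V1 W1 V2 W2 h1 h2
    simp only [Sat]
    refine exists_congr fun τ => and_congr_right fun _ => ih _ _ _ _ h1 ?_
    intro y hy
    by_cases hxy : y = x
    · subst hxy; simp
    · simp [Function.update_of_ne hxy, h2 y ⟨hy, hxy⟩]

theorem sat_sentence {AP : Type} (D : SODom) (K : KripkeTree AP) (φ : MSOL AP)
    (h : φ.IsSentence) (V1 W1 : ℕ → Node) (V2 W2 : ℕ → Set Node) :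
    Sat D K V1 V2 φ ↔ Sat D K W1 W2 φ := by
  apply sat_congr
  · simp [h.1]
  · simp [h.2]

def imp {AP : Type} (φ ψ : MSOL AP) : MSOL AP := .not (.and φ (.not ψ))
def dis {AP : Type} (φ ψ : MSOL AP) : MSOL AP := .not (.and (.not φ) (.not ψ))
def all {AP : Type} (x : ℕ) (φ : MSOL AP) : MSOL AP := .not (.exFO x (.not φ))

section
variable {AP : Type} {D : SODom} {K : KripkeTree AP} {V1 : ℕ → Node} {V2 : ℕ → Set Node}
theorem sat_imp {φ ψ : MSOL AP} : Sat D K V1 V2 (imp φ ψ) ↔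
    (Sat D K V1 V2 φ → Sat D K V1 V2 ψ) := by simp [imp, Sat]
theorem sat_dis {φ ψ : MSOL AP} : Sat D K V1 V2 (dis φ ψ) ↔
    (Sat D K V1 V2 φ ∨ Sat D K V1 V2 ψ) := by simp only [dis, Sat]; tauto
theorem sat_all {x : ℕ} {φ : MSOL AP} : Sat D K V1 V2 (all x φ) ↔
    ∀ τ ∈ K.T, Sat D K (Function.update V1 x τ) V2 φ := by simp [all, Sat]
end

/-! ### Translations -/

def tr {AP : Type} (δ : ℕ → MSOL AP) : MSOL AP → MSOL AP
  | .atom a x => .atom a x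
  | .le x y => .le x y
  | .mem x X => .mem x X
  | .not φ => .not (tr δ φ)
  | .and φ ψ => .and (tr δ φ) (tr δ ψ)
  | .exFO x φ => .exFO x (tr δ φ)
  | .exSO X φ => .exSO X (.and (δ X) (tr δ φ))

theorem tr_freeFO {AP : Type} (δ : ℕ → MSOL AP) (h : ∀ X, (δ X).freeFO = ∅) (φ : MSOL AP) :
    (tr δ φ).freeFO = φ.freeFO := by
  induction φ <;> simp_all [tr, MSOL.freeFO]

theorem tr_freeSO {AP : Type} (δ : ℕ → MSOL AP) (h : ∀ X, (δ X).freeSO = {X}) (φ : MSOL AP) :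
    (tr δ φ).freeSO = φ.freeSO := by
  induction φ <;> simp_all [tr, MSOL.freeSO]

theorem tr_sat {AP : Type} (δ : ℕ → MSOL AP) (D D' : SODom) (K : KripkeTree AP)
    (h : ∀ X V1 V2 S, (S ∈ D' K.T ∧ Sat D' K V1 (Function.update V2 X S) (δ X)) ↔ S ∈ D K.T)
    (φ : MSOL AP) : ∀ V1 V2, Sat D' K V1 V2 (tr δ φ) ↔ Sat D K V1 V2 φ := by
  induction φ with
  | atom | le | mem => intros; simp [tr, Sat]
  | not φ ih => intros; simp [tr, Sat, ih]
  | and φ ψ ih1 ih2 => intros; simp [tr, Sat, ih1, ih2]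
  | exFO x φ ih => intros; simp [tr, Sat, ih]
  | exSO X φ ih =>
    intro V1 V2
    simp only [tr, Sat, ih]
    refine exists_congr fun S => ?_
    rw [← and_assoc, h]

theorem leq_of {AP : Type} (δ : ℕ → MSOL AP) (D D' : SODom) (M : Set (KripkeTree AP))
    (h1 : ∀ X, (δ X).freeFO = ∅) (h2 : ∀ X, (δ X).freeSO = {X})
    (h : ∀ K : KripkeTree AP, ∀ X V1 V2 S,
      (S ∈ D' K.T ∧ Sat D' K V1 (Function.update V2 X S) (δ X)) ↔ S ∈ D K.T) :
    MLogic.Leq M ⟨fun _ => True, D⟩ ⟨fun _ => True, D'⟩ := by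
  intro φ hφ _
  refine ⟨tr δ φ, ⟨by rw [tr_freeFO δ h1, hφ.1], by rw [tr_freeSO δ h2, hφ.2]⟩, trivial, ?_⟩
  intro K _
  simp only [MLogic.KSat, tr_sat δ D D' K (h K)]

theorem path_comparable {T P : Set Node} (h : IsPathOf T P) :
    ∀ x ∈ P, ∀ y ∈ P, x <+: y ∨ y <+: x := by
  obtain ⟨⟨_, r, hr, hr1, hr2⟩, hc⟩ := h
  have key : ∀ σ : List ℕ, r ++ σ ∈ P → ∀ y ∈ P, r ++ σ <+: y ∨ y <+: r ++ σ := by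
    intro σ
    induction σ using List.reverseRecOn with
    | nil => intro _ y hy; left; simpa using hr1 y hy
    | append_singleton σ a ih =>
      intro hσ y hy
      have h0 := hr2 _ σ hσ (List.prefix_append _ _)
      rcases ih h0 y hy with ⟨ρ, hρ⟩ | h
      · cases ρ with
        | nil => right; rw [← hρ]; simp
        | cons b ρ =>
          left
          have : r ++ (σ ++ [b]) ∈ P := by
            apply hr2 (σ ++ b :: ρ)
            · rw [← List.append_assoc, hρ]; exact hy
            · exact ⟨ρ, by simp⟩
          have e := hc (r ++ σ) h0 a b (by simpa using hσ) (by simpa using this)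
          subst e
          exact ⟨ρ, by rw [← hρ]; simp⟩
      · right
        exact h.trans ⟨[a], by simp⟩
  intro x hx y hy
  obtain ⟨σ, rfl⟩ := hr1 x hx
  exact key σ hx y hy

def dPath {AP : Type} (X : ℕ) : MSOL AP :=
  all 0 (all 1 (imp (.and (.mem 0 X) (.mem 1 X)) (dis (.le 0 1) (.le 1 0))))

def dTree {AP : Type} (X : ℕ) : MSOL AP :=
  .exFO 0 (.and (.mem 0 X) (all 1 (imp (.mem 1 X) (.and (.le 0 1)
    (all 2 (imp (.and (.le 0 2) (.le 2 1)) (.mem 2 X)))))))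

theorem leq1 {AP : Type} (M : Set (KripkeTree AP)) : MLogic.Leq M (WMPL AP) (WMTL AP) := by
  apply leq_of dPath
  · intro X; ext z; simp [dPath, all, imp, dis, MSOL.freeFO]
  · intro X; simp [dPath, all, imp, dis, MSOL.freeSO]
  · intro K X V1 V2 S
    simp only [dPath, sat_all, sat_imp, sat_dis, Sat]
    simp only [weakDom, MTLdom, MPLdom, Set.mem_ofPred_eq, Function.update_apply]
    norm_num
    constructor
    · rintro ⟨⟨⟨h1, h2⟩, hf⟩, h⟩
      refine ⟨⟨⟨h1, h2⟩, ?_⟩, hf⟩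
      intro τ hτ n m hn hm
      rcases h _ (h1 hn) _ (h1 hm) hn hm with h | h
      · simpa using h.2.2
      · exact (show m = n by simpa using h.2.2).symm
    · rintro ⟨h, hf⟩
      refine ⟨⟨h.1, hf⟩, ?_⟩
      intro x hx y hy hxS hyS
      rcases path_comparable h x hxS y hyS with h | h
      · exact Or.inl ⟨hx, hy, h⟩
      · exact Or.inr ⟨hy, hx, h⟩

theorem kt_between {AP : Type} (K : KripkeTree AP) {r y x : Node} (hr : r ∈ K.T) (hx : x ∈ K.T)
    (h1 : r <+: y) (h2 : y <+: x) : y ∈ K.T := by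
  obtain ⟨_, a2, a3⟩ := K.rooted
  obtain ⟨ρ, rfl⟩ := (a2 r hr).trans h1
  obtain ⟨ρ', rfl⟩ := h2
  apply a3 (ρ ++ ρ')
  · simpa using hx
  · exact List.prefix_append _ _

theorem leq2 {AP : Type} (M : Set (KripkeTree AP)) : MLogic.Leq M (WMTL AP) (WMSO AP) := by
  apply leq_of dTree
  · intro X; ext z; simp [dTree, all, imp, dis, MSOL.freeFO]; omega
  · intro X; simp [dTree, all, imp, dis, MSOL.freeSO]
  · intro K X V1 V2 S
    simp only [dTree, sat_all, sat_imp, sat_dis, Sat]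
    simp only [weakDom, MTLdom, MSOdom, Set.mem_ofPred_eq, Function.update_apply]
    norm_num
    constructor
    · rintro ⟨⟨hS, hf⟩, r, hrT, hrS, h⟩
      refine ⟨⟨hS, r, hrS, fun τ hτ => (h τ (hS hτ) hτ).1.2.2, ?_⟩, hf⟩
      intro σ σ' hσ hp
      have hp' : r ++ σ' <+: r ++ σ := by simpa using hp
      have hT := kt_between K hrT (hS hσ) (List.prefix_append r σ') hp'
      exact (h _ (hS hσ) hσ).2 _ hT hrT hT (List.prefix_append r σ') hT (hS hσ) hp'
    · rintro ⟨⟨hS, r, hrS, h1, h2⟩, hf⟩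
      refine ⟨⟨hS, hf⟩, r, hS hrS, hrS, ?_⟩
      intro x hxT hxS
      refine ⟨⟨hS hrS, hxT, h1 x hxS⟩, ?_⟩
      rintro y hyT - - ⟨ρ, rfl⟩ - - ⟨ρ', rfl⟩
      apply h2 (ρ ++ ρ')
      · simpa using hxS
      · exact List.prefix_append _ _

/-! ### The trees -/

def N (i j : ℕ) : Node := List.replicate i 0 ++ List.replicate j 1

theorem N_le {i j i2 j2 : ℕ} : N i j <+: N i2 j2 ↔ (j = 0 ∧ i ≤ i2) ∨ (i = i2 ∧ j ≤ j2) := by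
  induction i generalizing i2 with
  | zero =>
    cases i2 with
    | zero =>
      simp only [N, List.replicate_zero, List.nil_append]
      constructor
      · intro h; have := h.length_le; simp at this; exact Or.inr ⟨trivial, this⟩
      · intro h
        obtain ⟨k, rfl⟩ : ∃ k, j2 = j + k := ⟨j2 - j, by omega⟩
        rw [List.replicate_add]; exact List.prefix_append _ _
    | succ i2 =>
      cases j with
      | zero => simp [N]
      | succ j => simp [N, List.replicate_succ]
  | succ i ih =>
    cases i2 with
    | zero => cases j2 <;> simp [N, List.replicate_succ]
    | succ i2 =>
      have := @ih i2
      simp only [N, List.replicate_succ, List.cons_append, List.cons_prefix_cons, true_and] at this ⊢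
      rw [this]; omega

theorem N_inj {i j i2 j2 : ℕ} (h : N i j = N i2 j2) : i = i2 ∧ j = j2 := by
  have h1 : N i j <+: N i2 j2 := by rw [h]
  have h2 : N i2 j2 <+: N i j := by rw [h]
  rw [N_le] at h1 h2
  omega

theorem N_pre {w : Node} {i j : ℕ} (h : w <+: N i j) :
    ∃ i' j', w = N i' j' ∧ ((j' = 0 ∧ i' ≤ i) ∨ (i' = i ∧ j' ≤ j)) := by
  have h1 := List.prefix_iff_eq_take.1 h
  refine ⟨min w.length i, min (w.length - i) j, ?_, ?_⟩
  · conv_lhs => rw [h1]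
    simp [N, List.take_append, List.take_replicate]
  · omega

theorem N_child {i j k i2 j2 : ℕ} (h : N i j ++ [k] = N i2 j2) :
    (i2 = i + 1 ∧ j2 = 0 ∧ j = 0) ∨ (i2 = i ∧ j2 = j + 1) := by
  have h1 : N i j <+: N i2 j2 := ⟨_, h⟩
  have h2 := congrArg List.length h
  rw [N_le] at h1
  simp [N] at h2
  omega

theorem N_child0 (i : ℕ) : N i 0 ++ [0] = N (i + 1) 0 := by
  simp [N, List.replicate_succ']

theorem N_child1 (i j : ℕ) : N i j ++ [1] = N i (j + 1) := by
  simp [N, List.replicate_succ']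

def TT (q : ℕ → Prop) : Set Node := {τ | ∃ i j, τ = N i j ∧ (j = 0 ∨ q i)}

theorem mem_TT {q : ℕ → Prop} {i j : ℕ} : N i j ∈ TT q ↔ (j = 0 ∨ q i) := by
  constructor
  · rintro ⟨i', j', h, h'⟩
    obtain ⟨rfl, rfl⟩ := N_inj h
    exact h'
  · intro h; exact ⟨i, j, rfl, h⟩

theorem TT_pre {q : ℕ → Prop} {w x : Node} (hx : x ∈ TT q) (h : w <+: x) : w ∈ TT q := by
  obtain ⟨i, j, rfl, hq⟩ := hx
  obtain ⟨i', j', rfl, h'⟩ := N_pre h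
  rw [mem_TT]
  rcases h' with h' | ⟨rfl, h'⟩
  · exact Or.inl h'.1
  · rcases hq with hq | hq
    · left; omega
    · exact Or.inr hq

def KT (AP : Type) (q : ℕ → Prop) : KripkeTree AP where
  T := TT q
  root := []
  rooted := by
    refine ⟨⟨0, 0, by simp [N], Or.inl rfl⟩, fun τ _ => List.nil_prefix, ?_⟩
    intro σ σ' h h'
    exact TT_pre h h'
  nonblocking := by
    rintro τ ⟨i, j, rfl, h⟩
    rcases h with rfl | h
    · exact ⟨0, by rw [N_child0]; exact mem_TT.2 (Or.inl rfl)⟩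
    · exact ⟨1, by rw [N_child1]; exact mem_TT.2 (Or.inr h)⟩
  Lab := fun _ => ∅

theorem KT_fin (AP : Type) (q : ℕ → Prop) : KT AP q ∈ finBrKT AP := by
  rintro τ ⟨i, j, rfl, h⟩
  apply Set.Finite.subset (Set.toFinite {N (i+1) 0, N i (j+1)})
  rintro τ' ⟨⟨i', j', rfl, h'⟩, k, hk⟩
  rcases N_child hk.symm with ⟨rfl, rfl, rfl⟩ | ⟨rfl, rfl⟩ <;> simp

/-! ### The game -/

def Close (d : ℕ) (S : Set (ℕ × ℕ)) : Prop :=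
  ∀ p ∈ S, ∀ q ∈ S, p.1 + q.2 = q.1 + p.2 ∨ (p.1 + d ≤ q.1 ∧ p.2 + d ≤ q.2) ∨
    (q.1 + d ≤ p.1 ∧ q.2 + d ≤ p.2)

theorem Close.mono {d e : ℕ} {S : Set (ℕ × ℕ)} (h : Close d S) (hde : e ≤ d) : Close e S := by
  intro p hp q hq
  have := h p hp q hq
  omega

theorem Close.swap {d : ℕ} {S : Set (ℕ × ℕ)} (h : Close d S) : Close d (Prod.swap ⁻¹' S) := by
  intro p hp q hq
  have := h _ hp _ hq
  simp only [Prod.fst_swap, Prod.snd_swap] at this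
  omega

theorem Close.ins {d : ℕ} {S : Set (ℕ × ℕ)} {p p' : ℕ} (h : Close d S)
    (h' : ∀ q ∈ S, p + q.2 = q.1 + p' ∨ (p + d ≤ q.1 ∧ p' + d ≤ q.2) ∨
    (q.1 + d ≤ p ∧ q.2 + d ≤ p')) : Close d (insert (p, p') S) := by
  rintro a (rfl | ha) b (rfl | hb)
  · left; rfl
  · exact h' b hb
  · have := h' a ha
    simp only
    omega
  · exact h a ha b hb

theorem Close.extend {d : ℕ} (hd : 1 ≤ d) {S : Set (ℕ × ℕ)} (h : Close (2 * d) S) (h0 : (0, 0) ∈ S) (p : ℕ) :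
    ∃ p', Close d (insert (p, p') S) := by
  classical
  -- nearest left point
  obtain ⟨a, haS, hap, hamax⟩ : ∃ a ∈ S, a.1 ≤ p ∧ ∀ c ∈ S, c.1 ≤ p → c.1 ≤ a.1 := by
    have hex : ∃ k, ∃ a ∈ S, a.1 ≤ p ∧ p - a.1 = k := ⟨_, (0, 0), h0, Nat.zero_le _, rfl⟩
    obtain ⟨a, ha, hap, hk⟩ := Nat.find_spec hex
    refine ⟨a, ha, hap, fun c hc hcp => ?_⟩
    have := Nat.find_min' hex ⟨c, hc, hcp, rfl⟩
    omega
  have hm := h.mono (show d ≤ 2 * d by omega)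
  by_cases hb : ∃ k, ∃ b ∈ S, p < b.1 ∧ b.1 = k
  · obtain ⟨b, hbS, hpb, hk⟩ := Nat.find_spec hb
    have hbmin : ∀ c ∈ S, p < c.1 → b.1 ≤ c.1 := by
      intro c hc hcp
      have := Nat.find_min' hb ⟨c, hc, hcp, rfl⟩
      omega
    have hab := h a haS b hbS
    by_cases h1 : p < a.1 + d
    · refine ⟨a.2 + (p - a.1), hm.ins fun q hq => ?_⟩
      have h2 := h a haS q hq
      have h3 := h b hbS q hq
      have h4 := hamax q hq
      have h5 := hbmin q hq
      omega
    · by_cases h1' : b.1 < p + d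
      · refine ⟨b.2 - (b.1 - p), hm.ins fun q hq => ?_⟩
        have h2 := h a haS q hq
        have h3 := h b hbS q hq
        have h4 := hamax q hq
        have h5 := hbmin q hq
        omega
      · refine ⟨a.2 + d, hm.ins fun q hq => ?_⟩
        have h2 := h a haS q hq
        have h3 := h b hbS q hq
        have h4 := hamax q hq
        have h5 := hbmin q hq
        omega
  · refine ⟨a.2 + (p - a.1), hm.ins fun q hq => ?_⟩
    have h2 := h a haS q hq
    have h4 := hamax q hq
    have h5 : ¬ p < q.1 := fun hlt => hb ⟨_, q, hq, hlt, rfl⟩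
    omega

/-- The subtree with root `a` and (at most) two maximal nodes `b`, `c`. -/
def U (a b c : Node) : Set Node := {x | a <+: x ∧ (x <+: b ∨ x <+: c)}

/-- Related nodes. -/
def Rel (S : Set (ℕ × ℕ)) (x x' : Node) : Prop :=
  ∃ i i' j, (i, i') ∈ S ∧ x = N i j ∧ x' = N i' j

theorem Rel.mono {S S' : Set (ℕ × ℕ)} {x x' : Node} (h : Rel S x x') (hS : S ⊆ S') :
    Rel S' x x' := by
  obtain ⟨i, i', j, h, h'⟩ := h
  exact ⟨i, i', j, hS h, h'⟩

theorem Rel.swap {S : Set (ℕ × ℕ)} {x x' : Node} (h : Rel S x x') :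
    Rel (Prod.swap ⁻¹' S) x' x := by
  obtain ⟨i, i', j, h, h', h''⟩ := h
  exact ⟨i', i, j, h, h'', h'⟩

theorem Rel.le {d : ℕ} (hd : 1 ≤ d) {S : Set (ℕ × ℕ)} (hS : Close d S) {x x' y y' : Node}
    (hx : Rel S x x') (hy : Rel S y y') : x <+: y ↔ x' <+: y' := by
  obtain ⟨i, i', j, h, rfl, rfl⟩ := hx
  obtain ⟨k, k', l, h', rfl, rfl⟩ := hy
  rw [N_le, N_le]
  have := hS _ h _ h'
  simp only at this
  omega

theorem Rel.eq {d : ℕ} (hd : 1 ≤ d) {S : Set (ℕ × ℕ)} (hS : Close d S) {x x' y y' : Node}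
    (hx : Rel S x x') (hy : Rel S y y') (h : x = y) : x' = y' := by
  have h1 := (Rel.le hd hS hx hy).1 (by rw [h])
  have h2 := (Rel.le hd hS hy hx).1 (by rw [h])
  exact h1.eq_of_length (le_antisymm h1.length_le h2.length_le)

/-- `Q`-condition compatible with the marker. -/
def Compat (Q : ℕ → ℕ → Prop) : Prop := Q = (fun n i => i < n) ∨ Q = (fun n i => i = n)

theorem Rel.mem {Q : ℕ → ℕ → Prop} (hQ : Compat Q) {d : ℕ} (hd : 1 ≤ d) {S : Set (ℕ × ℕ)}
    (hS : Close d S) {n m : ℕ} (hnm : (n, m) ∈ S) {x x' : Node} (hx : Rel S x x') :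
    x ∈ TT (Q n) ↔ x' ∈ TT (Q m) := by
  obtain ⟨i, i', j, h, rfl, rfl⟩ := hx
  rw [mem_TT, mem_TT]
  have := hS _ h _ hnm
  simp only at this
  rcases hQ with rfl | rfl
  · simp only; omega
  · simp only; omega

theorem Rel.extend {d : ℕ} (hd : 1 ≤ d) {S : Set (ℕ × ℕ)} (hS : Close (2 * d) S) (h0 : (0, 0) ∈ S)
    {q : ℕ → Prop} {x : Node} (hx : x ∈ TT q) :
    ∃ x' S', S ⊆ S' ∧ Close d S' ∧ Rel S' x x' := by
  obtain ⟨i, j, rfl, _⟩ := hx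
  obtain ⟨i', h⟩ := hS.extend hd h0 i
  exact ⟨N i' j, _, Set.subset_insert _ _, h, i, i', j, Set.mem_insert _ _, rfl, rfl⟩

def St (d n m : ℕ) (V1 V1' : ℕ → Node) (V2 V2' : ℕ → Set Node) (Q : ℕ → ℕ → Prop) : Prop :=
  ∃ S, Close d S ∧ (0, 0) ∈ S ∧ (n, m) ∈ S ∧
    (∀ x, V1 x ∈ TT (Q n) ∧ Rel S (V1 x) (V1' x)) ∧
    (∀ X, ∃ a b c a' b' c', V2 X = U a b c ∧ V2' X = U a' b' c' ∧
      Rel S a a' ∧ Rel S b b' ∧ Rel S c c')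

theorem St.swap {Q : ℕ → ℕ → Prop} (hQ : Compat Q) {d n m : ℕ} (hd : 1 ≤ d) {V1 V1' : ℕ → Node}
    {V2 V2' : ℕ → Set Node}
    (h : St d n m V1 V1' V2 V2' Q) : St d m n V1' V1 V2' V2 Q := by
  obtain ⟨S, hS, h0, hnm, h1, h2⟩ := h
  refine ⟨_, hS.swap, h0, hnm, ?_, ?_⟩
  · intro x
    exact ⟨((h1 x).2.mem hQ hd hS hnm).1 (h1 x).1, (h1 x).2.swap⟩
  · intro X
    obtain ⟨a, b, c, a', b', c', e, e', ha, hb, hc⟩ := h2 X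
    exact ⟨a', b', c', a, b, c, e', e, ha.swap, hb.swap, hc.swap⟩

theorem St.mono {Q : ℕ → ℕ → Prop} {d e n m : ℕ} (hde : e ≤ d) {V1 V1' : ℕ → Node}
    {V2 V2' : ℕ → Set Node}
    (h : St d n m V1 V1' V2 V2' Q) : St e n m V1 V1' V2 V2' Q := by
  obtain ⟨S, hS, h⟩ := h
  exact ⟨S, hS.mono hde, h⟩

theorem St.fo {Q : ℕ → ℕ → Prop} (hQ : Compat Q) {d n m : ℕ} (hd : 1 ≤ d) {V1 V1' : ℕ → Node}
    {V2 V2' : ℕ → Set Node} (h : St (2 * d) n m V1 V1' V2 V2' Q) (x : ℕ)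
    {τ : Node} (hτ : τ ∈ TT (Q n)) : ∃ τ' ∈ TT (Q m),
      St d n m (Function.update V1 x τ) (Function.update V1' x τ') V2 V2' Q := by
  obtain ⟨S, hS, h0, hnm, h1, h2⟩ := h
  obtain ⟨τ', S', hSS, hS', hr⟩ := Rel.extend hd hS h0 hτ
  refine ⟨τ', (hr.mem hQ hd hS' (hSS hnm)).1 hτ, S', hS', hSS h0, hSS hnm, ?_, ?_⟩
  · intro y
    by_cases hy : y = x
    · subst hy; simp [hτ, hr]
    · simp only [Function.update_of_ne hy]
      exact ⟨(h1 y).1, (h1 y).2.mono hSS⟩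
  · intro X
    obtain ⟨a, b, c, a', b', c', e, e', ha, hb, hc⟩ := h2 X
    exact ⟨a, b, c, a', b', c', e, e', ha.mono hSS, hb.mono hSS, hc.mono hSS⟩

/-- Domain described by triples of nodes. -/
def DomOK (D : SODom) (Q : ℕ → ℕ → Prop) (e : Prop) : Prop :=
  ∀ n, ∀ S, S ∈ D (TT (Q n)) ↔ ∃ a b c, a ∈ TT (Q n) ∧ b ∈ TT (Q n) ∧ c ∈ TT (Q n) ∧
    a <+: b ∧ a <+: c ∧ (e → b = c) ∧ S = U a b c

theorem St.so {Q : ℕ → ℕ → Prop} (hQ : Compat Q) {D : SODom} {e : Prop} (hD : DomOK D Q e)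
    {d n m : ℕ} (hd : 1 ≤ d) {V1 V1' : ℕ → Node}
    {V2 V2' : ℕ → Set Node} (h : St (8 * d) n m V1 V1' V2 V2' Q) (X : ℕ)
    {A : Set Node} (hA : A ∈ D (TT (Q n))) : ∃ A' ∈ D (TT (Q m)),
      St d n m V1 V1' (Function.update V2 X A) (Function.update V2' X A') Q := by
  obtain ⟨S, hS, h0, hnm, h1, h2⟩ := h
  obtain ⟨a, b, c, ha, hb, hc, hab, hac, hbc, rfl⟩ := (hD n A).1 hA
  rw [show 8 * d = 2 * (2 * (2 * d)) by ring] at hS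
  obtain ⟨a', S1, hSS1, hS1, hra⟩ := Rel.extend (by omega) hS h0 ha
  obtain ⟨b', S2, hSS2, hS2, hrb⟩ := Rel.extend (by omega) hS1 (hSS1 h0) hb
  obtain ⟨c', S3, hSS3, hS3, hrc⟩ := Rel.extend hd hS2 (hSS2 (hSS1 h0)) hc
  have hSS : S ⊆ S3 := hSS1.trans (hSS2.trans hSS3)
  replace hra := hra.mono (hSS2.trans hSS3)
  replace hrb := hrb.mono hSS3
  refine ⟨U a' b' c', (hD m _).2 ⟨a', b', c', (hra.mem hQ hd hS3 (hSS hnm)).1 ha,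
    (hrb.mem hQ hd hS3 (hSS hnm)).1 hb, (hrc.mem hQ hd hS3 (hSS hnm)).1 hc,
    (hra.le hd hS3 hrb).1 hab, (hra.le hd hS3 hrc).1 hac,
    fun he => hrb.eq hd hS3 hrc (hbc he), rfl⟩, S3, hS3, hSS h0, hSS hnm, ?_, ?_⟩
  · intro y
    exact ⟨(h1 y).1, (h1 y).2.mono hSS⟩
  · intro Y
    by_cases hy : Y = X
    · subst hy
      exact ⟨a, b, c, a', b', c', by simp, by simp, hra, hrb, hrc⟩
    · simp only [Function.update_of_ne hy]
      obtain ⟨a, b, c, a', b', c', e, e', ha, hb, hc⟩ := h2 Y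
      exact ⟨a, b, c, a', b', c', e, e', ha.mono hSS, hb.mono hSS, hc.mono hSS⟩

def qr {AP : Type} : MSOL AP → ℕ
  | .atom _ _ => 0
  | .le _ _ => 0
  | .mem _ _ => 0
  | .not φ => qr φ
  | .and φ ψ => max (qr φ) (qr ψ)
  | .exFO _ φ => qr φ + 1
  | .exSO _ φ => qr φ + 1

theorem game {AP : Type} {Q : ℕ → ℕ → Prop} (hQ : Compat Q) {D : SODom} {e : Prop}
    (hD : DomOK D Q e) (φ : MSOL AP) : ∀ (n m : ℕ) (V1 V1' : ℕ → Node) (V2 V2' : ℕ → Set Node),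
    St (8 ^ qr φ) n m V1 V1' V2 V2' Q →
    (Sat D (KT AP (Q n)) V1 V2 φ ↔ Sat D (KT AP (Q m)) V1' V2' φ) := by
  induction φ with
  | atom a x => intro n m V1 V1' V2 V2' h; simp [Sat, KT]
  | le x y =>
    rintro n m V1 V1' V2 V2' ⟨S, hS, h0, hnm, h1, h2⟩
    have hd : 1 ≤ 8 ^ qr (AP := AP) (.le x y) := Nat.one_le_pow _ _ (by norm_num)
    simp only [Sat, KT]
    rw [(h1 x).2.mem hQ hd hS hnm, (h1 y).2.mem hQ hd hS hnm, (h1 x).2.le hd hS (h1 y).2]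
  | mem x X =>
    rintro n m V1 V1' V2 V2' ⟨S, hS, h0, hnm, h1, h2⟩
    have hd : 1 ≤ 8 ^ qr (AP := AP) (.mem x X) := Nat.one_le_pow _ _ (by norm_num)
    obtain ⟨a, b, c, a', b', c', e, e', ha, hb, hc⟩ := h2 X
    simp only [Sat, e, e', U, Set.mem_ofPred_eq]
    rw [ha.le hd hS (h1 x).2, (h1 x).2.le hd hS hb, (h1 x).2.le hd hS hc]
  | not φ ih =>
    intro n m V1 V1' V2 V2' h
    simp only [Sat]
    rw [ih n m V1 V1' V2 V2' h]
  | and φ ψ ih1 ih2 =>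
    intro n m V1 V1' V2 V2' h
    simp only [Sat]
    rw [ih1 n m V1 V1' V2 V2' (h.mono (Nat.pow_le_pow_right (by norm_num) (le_max_left _ _))),
      ih2 n m V1 V1' V2 V2' (h.mono (Nat.pow_le_pow_right (by norm_num) (le_max_right _ _)))]
  | exFO x φ ih =>
    have hd : 1 ≤ 8 ^ qr φ := Nat.one_le_pow _ _ (by norm_num)
    have key : ∀ (n m : ℕ) (V1 V1' : ℕ → Node) (V2 V2' : ℕ → Set Node),
        St (8 ^ qr (MSOL.exFO x φ)) n m V1 V1' V2 V2' Q →
        Sat D (KT AP (Q n)) V1 V2 (.exFO x φ) → Sat D (KT AP (Q m)) V1' V2' (.exFO x φ) := by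
      rintro n m V1 V1' V2 V2' h ⟨τ, hτ, hs⟩
      have h' : St (2 * 8 ^ qr φ) n m V1 V1' V2 V2' Q :=
        h.mono (by simp only [qr, pow_succ]; omega)
      obtain ⟨τ', hτ', hst⟩ := h'.fo hQ hd x hτ
      exact ⟨τ', hτ', (ih _ _ _ _ _ _ hst).1 hs⟩
    intro n m V1 V1' V2 V2' h
    exact ⟨key _ _ _ _ _ _ h, key _ _ _ _ _ _ (h.swap hQ (Nat.one_le_pow _ _ (by norm_num)))⟩
  | exSO X φ ih =>
    have hd : 1 ≤ 8 ^ qr φ := Nat.one_le_pow _ _ (by norm_num)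
    have key : ∀ (n m : ℕ) (V1 V1' : ℕ → Node) (V2 V2' : ℕ → Set Node),
        St (8 ^ qr (MSOL.exSO X φ)) n m V1 V1' V2 V2' Q →
        Sat D (KT AP (Q n)) V1 V2 (.exSO X φ) → Sat D (KT AP (Q m)) V1' V2' (.exSO X φ) := by
      rintro n m V1 V1' V2 V2' h ⟨τ, hτ, hs⟩
      have h' : St (8 * 8 ^ qr φ) n m V1 V1' V2 V2' Q :=
        h.mono (by simp only [qr, pow_succ]; omega)
      obtain ⟨τ', hτ', hst⟩ := h'.so hQ hD hd X hτ
      exact ⟨τ', hτ', (ih _ _ _ _ _ _ hst).1 hs⟩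
    intro n m V1 V1' V2 V2' h
    exact ⟨key _ _ _ _ _ _ h, key _ _ _ _ _ _ (h.swap hQ (Nat.one_le_pow _ _ (by norm_num)))⟩

theorem close_init (d : ℕ) : Close d {(0, 0), (d, d + 1)} := by
  intro p hp q hq
  simp only [Set.mem_insert_iff, Set.mem_singleton_iff] at hp hq
  rcases hp with rfl | rfl <;> rcases hq with rfl | rfl <;> dsimp only <;> omega

theorem not_leq_of {AP : Type} {Q : ℕ → ℕ → Prop} (hQ : Compat Q) {D D' : SODom} {e : Prop}
    (hD : DomOK D Q e) (ψ : MSOL AP) (hψ : ψ.IsSentence)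
    (hsep : ∀ n, 1 ≤ n → ((∃ V1 V2, Sat D' (KT AP (Q n)) V1 V2 ψ) ↔
      ¬ (∃ V1 V2, Sat D' (KT AP (Q (n+1))) V1 V2 ψ))) :
    ¬ MLogic.Leq (finBrKT AP) ⟨fun _ => True, D'⟩ ⟨fun _ => True, D⟩ := by
  intro h
  obtain ⟨φ, hφ, _, hK⟩ := h ψ hψ trivial
  have hd : 1 ≤ 8 ^ qr φ := Nat.one_le_pow _ _ (by norm_num)
  have a1 := hK _ (KT_fin AP (Q (8 ^ qr φ)))
  have a2 := hK _ (KT_fin AP (Q (8 ^ qr φ + 1)))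
  have a3 := hsep _ hd
  simp only [MLogic.KSat] at a1 a2
  rw [a1, a2] at a3
  have g := game hQ hD φ (8 ^ qr φ) (8 ^ qr φ + 1) (fun _ => N 0 0) (fun _ => N 0 0)
    (fun _ => U (N 0 0) (N 0 0) (N 0 0)) (fun _ => U (N 0 0) (N 0 0) (N 0 0)) (by
      have hr : Rel {(0, 0), (8 ^ qr φ, 8 ^ qr φ + 1)} (N 0 0) (N 0 0) :=
        ⟨0, 0, 0, by simp, rfl, rfl⟩
      refine ⟨{(0, 0), (8 ^ qr φ, 8 ^ qr φ + 1)}, close_init _, by simp, by simp,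
        fun x => ⟨mem_TT.2 (Or.inl rfl), hr⟩,
        fun X => ⟨_, _, _, _, _, _, rfl, rfl, hr, hr, hr⟩⟩)
  have b : ∀ K : KripkeTree AP, (∃ V1 V2, Sat D K V1 V2 φ) ↔
      Sat D K (fun _ => N 0 0) (fun _ => U (N 0 0) (N 0 0) (N 0 0)) φ := fun K =>
    ⟨fun ⟨V1, V2, h⟩ => (sat_sentence D K φ hφ _ _ _ _).1 h, fun h => ⟨_, _, h⟩⟩
  rw [b, b, g] at a3
  tauto

/-! ### Domain descriptions -/

theorem U_tree {q : ℕ → Prop} {a b c : Node} (hb : b ∈ TT q) (hc : c ∈ TT q)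
    (hab : a <+: b) : U a b c ⊆ TT q ∧ IsTreeRooted (U a b c) a ∧ (U a b c).Finite := by
  refine ⟨?_, ⟨⟨List.prefix_rfl, Or.inl hab⟩, fun τ h => h.1, ?_⟩, ?_⟩
  · rintro x ⟨_, h | h⟩
    · exact TT_pre hb h
    · exact TT_pre hc h
  · rintro σ σ' ⟨_, h⟩ hp
    have hp' : a ++ σ' <+: a ++ σ := by simpa using hp
    exact ⟨List.prefix_append _ _, h.imp hp'.trans hp'.trans⟩
  · apply Set.Finite.subset (s := {x | x ∈ b.inits} ∪ {x | x ∈ c.inits})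
    · exact (List.finite_toSet _).union (List.finite_toSet _)
    · rintro x ⟨_, h | h⟩
      · left; simpa using h
      · right; simpa using h

theorem tree_between {S : Set Node} {r : Node} (h : IsTreeRooted S r) {x y : Node}
    (hy : y ∈ S) (h1 : r <+: x) (h2 : x <+: y) : x ∈ S := by
  obtain ⟨ρ, rfl⟩ := h1
  obtain ⟨ρ', rfl⟩ := h2
  exact h.2.2 (ρ ++ ρ') ρ (by simpa using hy) (List.prefix_append _ _)

theorem dom_path : DomOK (weakDom MPLdom) (fun n i => i < n) True := by
  intro n S
  constructor
  · rintro ⟨h, hf⟩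
    have hc := path_comparable h
    obtain ⟨⟨hST, r, hr⟩, _⟩ := h
    obtain ⟨b, hb, hmax⟩ := Set.exists_max_image S List.length hf ⟨r, hr.1⟩
    refine ⟨r, b, b, hST hr.1, hST hb, hST hb, hr.2.1 b hb, hr.2.1 b hb, fun _ => rfl, ?_⟩
    ext x
    constructor
    · intro hx
      refine ⟨hr.2.1 x hx, Or.inl ?_⟩
      rcases hc x hx b hb with h | h
      · exact h
      · rw [h.eq_of_length (le_antisymm h.length_le (hmax x hx))]
    · rintro ⟨h1, h | h⟩ <;> exact tree_between hr hb h1 h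
  · rintro ⟨a, b, c, ha, hb, hc, hab, hac, hbc, rfl⟩
    obtain rfl := hbc trivial
    obtain ⟨h1, h2, h3⟩ := U_tree (c := b) hb hb hab
    refine ⟨⟨⟨h1, a, h2⟩, ?_⟩, h3⟩
    rintro τ _ n m ⟨_, hn⟩ ⟨_, hm⟩
    rw [or_self] at hn hm
    rcases List.prefix_or_prefix_of_prefix hn hm with h | h
    · simpa using h
    · exact (show m = n by simpa using h).symm

theorem dom_tree : DomOK (weakDom MTLdom) (fun n i => i = n) False := by
  intro n S
  constructor
  · rintro ⟨⟨hST, r, hr⟩, hf⟩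
    have key : ∀ A : Set Node, (∀ x ∈ A ∩ S, ∀ y ∈ A ∩ S, x <+: y ∨ y <+: x) →
        ∃ b ∈ S, ∀ x ∈ A ∩ S, x <+: b := by
      intro A hA
      rcases Set.eq_empty_or_nonempty (A ∩ S) with h | h
      · exact ⟨r, hr.1, by simp [h]⟩
      · obtain ⟨b, hb, hmax⟩ := Set.exists_max_image (A ∩ S) List.length
          (hf.subset Set.inter_subset_right) h
        refine ⟨b, hb.2, fun x hx => ?_⟩
        rcases hA x hx b hb with h | h
        · exact h
        · rw [h.eq_of_length (le_antisymm h.length_le (hmax x hx))]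
    obtain ⟨b, hb, hbm⟩ := key {x | ∃ i, x = N i 0} (by
      rintro x ⟨⟨i, rfl⟩, _⟩ y ⟨⟨j, rfl⟩, _⟩
      rw [N_le, N_le]; omega)
    obtain ⟨c, hc, hcm⟩ := key {x | ∃ j, x = N n j} (by
      rintro x ⟨⟨i, rfl⟩, _⟩ y ⟨⟨j, rfl⟩, _⟩
      rw [N_le, N_le]; omega)
    refine ⟨r, b, c, hST hr.1, hST hb, hST hc, hr.2.1 b hb, hr.2.1 c hc, False.elim, ?_⟩
    ext x
    constructor
    · intro hx
      refine ⟨hr.2.1 x hx, ?_⟩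
      obtain ⟨i, j, rfl, rfl | rfl⟩ := hST hx
      · exact Or.inl (hbm _ ⟨⟨i, rfl⟩, hx⟩)
      · exact Or.inr (hcm _ ⟨⟨j, rfl⟩, hx⟩)
    · rintro ⟨h1, h | h⟩
      · exact tree_between hr hb h1 h
      · exact tree_between hr hc h1 h
  · rintro ⟨a, b, c, ha, hb, hc, hab, hac, hbc, rfl⟩
    obtain ⟨h1, h2, h3⟩ := U_tree hb hc hab
    exact ⟨⟨h1, a, h2⟩, h3⟩

/-! ### The separating sentence -/

def fSucc {AP : Type} (a b : ℕ) : MSOL AP :=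
  .and (.le a b) (.and (.not (.le b a))
    (all 4 (imp (.and (.le a 4) (.le 4 b)) (dis (.le 4 a) (.le b 4)))))

def fBr {AP : Type} (x : ℕ) : MSOL AP :=
  .exFO 2 (.exFO 3 (.and (.and (.le x 2) (.le x 3)) (.and (.not (.le 2 3)) (.not (.le 3 2)))))

def fM {AP : Type} (x : ℕ) : MSOL AP := all 5 (imp (fSucc x 5) (.mem 5 0))

def fRoot {AP : Type} (x : ℕ) : MSOL AP := all 4 (.le x 4)

def fPsi {AP : Type} : MSOL AP :=
  .exSO 0 (.and (all 0 (imp (fRoot 0) (fM 0))) (.and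
    (all 0 (all 1 (imp (.and (fSucc 0 1) (fBr 1))
      (.and (imp (fM 0) (.not (fM 1))) (imp (.not (fM 1)) (fM 0))))))
    (all 0 (imp (.and (fBr 0) (all 1 (imp (fSucc 0 1) (.not (fBr 1))))) (.not (fM 0))))))

theorem fPsi_sentence {AP : Type} : (fPsi : MSOL AP).IsSentence := by
  constructor
  · ext z
    simp [fPsi, fRoot, fM, fBr, fSucc, all, imp, dis, MSOL.freeFO]
    omega
  · ext z
    simp [fPsi, fRoot, fM, fBr, fSucc, all, imp, dis, MSOL.freeSO]

section
variable {AP : Type} {D : SODom} {q : ℕ → Prop} {V1 : ℕ → Node} {V2 : ℕ → Set Node}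

theorem sat_succ {a b : ℕ} (ha : a ≠ 4) (hb : b ≠ 4) (hA : V1 a ∈ TT q) (hB : V1 b ∈ TT q) :
    Sat D (KT AP q) V1 V2 (fSucc a b) ↔ ∃ k, V1 b = V1 a ++ [k] := by
  simp only [fSucc, Sat, sat_all, sat_imp, sat_dis, Function.update_self,
    Function.update_of_ne ha, Function.update_of_ne hb]
  simp only [KT]
  constructor
  · rintro ⟨⟨_, _, ρ, hρ⟩, h2, h3⟩
    cases ρ with
    | nil => exact absurd ⟨hB, hA, by rw [← hρ]; simp⟩ h2
    | cons k ρ =>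
      refine ⟨k, ?_⟩
      have hp : V1 a ++ [k] <+: V1 b := ⟨ρ, by rw [← hρ]; simp⟩
      have hT := TT_pre hB hp
      rcases h3 _ hT ⟨⟨hA, hT, List.prefix_append _ _⟩, hT, hB, hp⟩ with h | h
      · have := h.2.2.length_le
        simp at this
      · exact h.2.2.eq_of_length (le_antisymm h.2.2.length_le hp.length_le)
  · rintro ⟨k, hk⟩
    refine ⟨⟨hA, hB, by rw [hk]; exact List.prefix_append _ _⟩, ?_, ?_⟩
    · rintro ⟨_, _, h⟩
      have := h.length_le
      simp [hk] at this
    · rintro w hw ⟨⟨_, _, h1⟩, _, _, h2⟩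
      rw [hk] at h2
      rcases List.prefix_concat_iff.1 h2 with h | h
      · right; refine ⟨hB, hw, ?_⟩; rw [h, hk]
      · left; exact ⟨hw, hA, h⟩

theorem sat_br {x : ℕ} (hx : x ≠ 2) (hx' : x ≠ 3) (hX : V1 x ∈ TT q) :
    Sat D (KT AP q) V1 V2 (fBr x) ↔ ∃ u ∈ TT q, ∃ v ∈ TT q, V1 x <+: u ∧ V1 x <+: v ∧
      ¬ u <+: v ∧ ¬ v <+: u := by
  simp only [fBr, Sat, Function.update_self, Function.update_of_ne hx, Function.update_of_ne hx',
    Function.update_of_ne (show (2:ℕ) ≠ 3 by norm_num)]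
  simp only [KT]
  constructor
  · rintro ⟨u, hu, v, hv, ⟨h1, h2⟩, h3, h4⟩
    exact ⟨u, hu, v, hv, h1.2.2, h2.2.2, fun h => h3 ⟨hu, hv, h⟩, fun h => h4 ⟨hv, hu, h⟩⟩
  · rintro ⟨u, hu, v, hv, h1, h2, h3, h4⟩
    exact ⟨u, hu, v, hv, ⟨⟨hX, hu, h1⟩, hX, hv, h2⟩, fun h => h3 h.2.2, fun h => h4 h.2.2⟩

theorem sat_M {x : ℕ} (hx : x ≠ 4) (hx' : x ≠ 5) (hX : V1 x ∈ TT q) :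
    Sat D (KT AP q) V1 V2 (fM x) ↔ ∀ k, V1 x ++ [k] ∈ TT q → V1 x ++ [k] ∈ V2 0 := by
  simp only [fM, sat_all, sat_imp]
  rw [show (KT AP q).T = TT q from rfl]
  constructor
  · intro h k hk
    have := h _ hk ((sat_succ hx (by norm_num) (by simpa [Function.update_of_ne hx'] using hX)
      (by simpa using hk)).2 ⟨k, by simp [Function.update_of_ne hx']⟩)
    simpa [Sat] using this
  · intro h y hy hs
    rw [sat_succ hx (by norm_num) (by simpa [Function.update_of_ne hx'] using hX)
      (by simpa using hy)] at hs
    obtain ⟨k, hk⟩ := hs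
    simp [Function.update_of_ne hx'] at hk
    subst hk
    simpa [Sat] using h k hy

def BrT (q : ℕ → Prop) (x : Node) : Prop := ∃ u ∈ TT q, ∃ v ∈ TT q, x <+: u ∧ x <+: v ∧
      ¬ u <+: v ∧ ¬ v <+: u

def MT (q : ℕ → Prop) (X : Set Node) (x : Node) : Prop :=
  ∀ k, x ++ [k] ∈ TT q → x ++ [k] ∈ X

theorem sat_psi : (∃ V1 V2, Sat D (KT AP q) V1 V2 fPsi) ↔ ∃ X ∈ D (TT q), MT q X [] ∧
    (∀ x ∈ TT q, ∀ k, x ++ [k] ∈ TT q → BrT q (x ++ [k]) → (MT q X x ↔ ¬ MT q X (x ++ [k]))) ∧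
    (∀ x ∈ TT q, BrT q x → (∀ k, x ++ [k] ∈ TT q → ¬ BrT q (x ++ [k])) → ¬ MT q X x) := by
  have hnil : [] ∈ TT q := ⟨0, 0, by simp [N], Or.inl rfl⟩
  have main : ∀ V1 V2, Sat D (KT AP q) V1 V2 fPsi ↔ ∃ X ∈ D (TT q), MT q X [] ∧
    (∀ x ∈ TT q, ∀ k, x ++ [k] ∈ TT q → BrT q (x ++ [k]) → (MT q X x ↔ ¬ MT q X (x ++ [k]))) ∧
    (∀ x ∈ TT q, BrT q x → (∀ k, x ++ [k] ∈ TT q → ¬ BrT q (x ++ [k])) → ¬ MT q X x) := by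
    intro V1 V2
    simp only [fPsi, Sat, sat_all, sat_imp]
    simp only [show (KT AP q).T = TT q from rfl]
    refine exists_congr fun X => and_congr_right fun _ => ?_
    refine and_congr ?_ (and_congr ?_ ?_)
    · constructor
      · intro h
        have := h [] hnil (by
          rw [fRoot, sat_all]
          intro w hw
          simp [Sat, KT, hnil]
          exact hw)
        rw [sat_M (by norm_num) (by norm_num) (by simpa using hnil)] at this
        simpa [MT] using this
      · intro h x hx hr
        have : x = [] := by
          rw [fRoot, sat_all] at hr
          have := hr [] hnil
          simpa [Sat] using this.2.2
        subst this
        rw [sat_M (by norm_num) (by norm_num) (by simpa using hnil)]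
        simpa [MT] using h
    · constructor
      · intro h x hx k hk hb
        have := h x hx _ hk
        rw [sat_M (by norm_num) (by norm_num) (by simpa using hx),
          sat_M (by norm_num) (by norm_num) (by simpa using hk),
          sat_succ (by norm_num) (by norm_num) (by simpa using hx) (by simpa using hk),
          sat_br (by norm_num) (by norm_num) (by simpa using hk)] at this
        have h' := this ⟨⟨k, by simp⟩, by simpa [BrT] using hb⟩
        simp only [Function.update_self, Function.update_of_ne (show (0:ℕ) ≠ 1 by norm_num)] at h'
        exact ⟨h'.1, h'.2⟩
      · intro h x hx y hy
        rw [sat_M (by norm_num) (by norm_num) (by simpa using hx),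
          sat_M (by norm_num) (by norm_num) (by simpa using hy),
          sat_succ (by norm_num) (by norm_num) (by simpa using hx) (by simpa using hy),
          sat_br (by norm_num) (by norm_num) (by simpa using hy)]
        simp only [Function.update_self, Function.update_of_ne (show (0:ℕ) ≠ 1 by norm_num)]
        rintro ⟨⟨k, rfl⟩, hb⟩
        have := h x hx k hy hb
        exact ⟨this.1, this.2⟩
    · refine forall₂_congr fun x hx => ?_
      rw [sat_M (by norm_num) (by norm_num) (by simpa using hx),
        sat_br (by norm_num) (by norm_num) (by simpa using hx)]
      rw [and_imp]
      simp only [Function.update_self]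
      refine imp_congr Iff.rfl (imp_congr ?_ Iff.rfl)
      constructor
      · intro h k hk hb
        have := h _ hk
        rw [sat_succ (by norm_num) (by norm_num) (by simpa using hx) (by simpa using hk),
          sat_br (by norm_num) (by norm_num) (by simpa using hk)] at this
        simp only [Function.update_self, Function.update_of_ne (show (0:ℕ) ≠ 1 by norm_num)] at this
        exact this ⟨k, rfl⟩ hb
      · intro h y hy
        rw [sat_succ (by norm_num) (by norm_num) (by simpa using hx) (by simpa using hy),
          sat_br (by norm_num) (by norm_num) (by simpa using hy)]
        simp only [Function.update_self, Function.update_of_ne (show (0:ℕ) ≠ 1 by norm_num)]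
        rintro ⟨k, rfl⟩
        exact h k hy
  constructor
  · rintro ⟨V1, V2, h⟩
    exact (main V1 V2).1 h
  · intro h
    exact ⟨fun _ => [], fun _ => ∅, (main _ _).2 h⟩

theorem psi_even {b : ℕ} (hb1 : 1 ≤ b) (hbr : ∀ i j, BrT q (N i j) ↔ (j = 0 ∧ i < b)) :
    (∃ V1 V2, Sat D (KT AP q) V1 V2 fPsi) ↔
      ∃ X ∈ D (TT q), (∀ i < b, MT q X (N i 0) ↔ Even i) ∧ Even b := by
  rw [sat_psi]
  refine exists_congr fun X => and_congr_right fun _ => ?_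
  have hN : N 0 0 = [] := rfl
  have hsp : ∀ i, N i 0 ∈ TT q := fun i => mem_TT.2 (Or.inl rfl)
  constructor
  · rintro ⟨h1, h2, h3⟩
    have h4 : ∀ i < b, MT q X (N i 0) ↔ Even i := by
      intro i
      induction i with
      | zero => intro _; simpa [hN] using h1
      | succ i ih =>
        intro hi
        have := h2 (N i 0) (hsp i) 0 (by rw [N_child0]; exact hsp _)
          (by rw [N_child0, hbr]; exact ⟨rfl, hi⟩)
        rw [N_child0, ih (by omega)] at this
        rw [Nat.even_add_one, this, not_not]
    refine ⟨h4, ?_⟩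
    have := h3 (N (b-1) 0) (hsp _) (by rw [hbr]; omega) (by
      rintro k ⟨i, j, hk, _⟩
      rw [hk, hbr]
      have := N_child hk
      omega)
    rw [h4 _ (by omega)] at this
    obtain ⟨c, rfl⟩ : ∃ c, b = c + 1 := ⟨b - 1, by omega⟩
    rw [Nat.even_add_one]
    simpa using this
  · rintro ⟨h4, hbe⟩
    refine ⟨?_, ?_, ?_⟩
    · rw [← hN, h4 0 (by omega)]; simp
    · rintro x ⟨i, j, rfl, _⟩ k ⟨i', j', hk, _⟩ hb
      rw [hk] at hb ⊢
      rw [hbr] at hb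
      have h5 := N_child hk
      obtain ⟨rfl, rfl, rfl⟩ : i' = i + 1 ∧ j' = 0 ∧ j = 0 := by omega
      rw [h4 _ hb.2, h4 i (by omega), Nat.even_add_one, not_not]
    · rintro x ⟨i, j, rfl, _⟩ hb h
      rw [hbr] at hb
      obtain ⟨rfl, hb⟩ := hb
      have := h 0 (by rw [N_child0]; exact hsp _)
      rw [N_child0, hbr] at this
      obtain rfl : b = i + 1 := by omega
      rw [h4 i hb]
      rwa [Nat.even_add_one] at hbe

end

theorem br_lt (n : ℕ) (i j : ℕ) : BrT (fun i => i < n) (N i j) ↔ (j = 0 ∧ i < n) := by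
  constructor
  · rintro ⟨u, ⟨a, b, rfl, hu⟩, v, ⟨c, d, rfl, hv⟩, h1, h2, h3, h4⟩
    rw [N_le] at h1 h2 h3 h4
    omega
  · rintro ⟨rfl, h⟩
    refine ⟨N i 1, mem_TT.2 (Or.inr h), N (i+1) 0, mem_TT.2 (Or.inl rfl), ?_, ?_, ?_, ?_⟩ <;>
      rw [N_le] <;> omega

theorem br_eq (n : ℕ) (i j : ℕ) : BrT (fun i => i = n) (N i j) ↔ (j = 0 ∧ i < n + 1) := by
  constructor
  · rintro ⟨u, ⟨a, b, rfl, hu⟩, v, ⟨c, d, rfl, hv⟩, h1, h2, h3, h4⟩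
    rw [N_le] at h1 h2 h3 h4
    omega
  · rintro ⟨rfl, h⟩
    refine ⟨N n 1, mem_TT.2 (Or.inr rfl), N (n+1) 0, mem_TT.2 (Or.inl rfl), ?_, ?_, ?_, ?_⟩ <;>
      rw [N_le] <;> omega

theorem psi_tree {AP : Type} (n : ℕ) (hn : 1 ≤ n) :
    (∃ V1 V2, Sat (weakDom MTLdom) (KT AP (fun i => i < n)) V1 V2 fPsi) ↔ Even n := by
  rw [psi_even hn (br_lt n)]
  refine ⟨fun ⟨_, _, _, h⟩ => h, fun h => ?_⟩
  refine ⟨{x | ∃ i j, x = N i j ∧ i ≤ n ∧ (j = 0 ∨ (j = 1 ∧ i < n ∧ Even i))}, ⟨⟨?_, ?_⟩, ?_⟩, ?_, h⟩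
  · rintro x ⟨i, j, rfl, h1, h2⟩
    rw [mem_TT]; omega
  · refine ⟨[], ⟨0, 0, rfl, by omega, by omega⟩, fun _ _ => List.nil_prefix, ?_⟩
    rintro σ σ' ⟨i, j, hσ, h1, h2⟩ hp
    rw [List.nil_append] at hσ ⊢
    subst hσ
    obtain ⟨i', j', rfl, h3⟩ := N_pre hp
    refine ⟨i', j', rfl, by omega, ?_⟩
    rcases h3 with h3 | ⟨rfl, h3⟩
    · exact Or.inl h3.1
    · rcases h2 with h2 | h2
      · left; omega
      · by_cases hj : j' = 0
        · exact Or.inl hj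
        · exact Or.inr ⟨by omega, h2.2⟩
  · apply Set.Finite.subset (((Set.finite_Iic n).prod (Set.finite_Iic 1)).image
      (fun p : ℕ × ℕ => N p.1 p.2))
    rintro x ⟨i, j, rfl, h1, h2⟩
    exact ⟨(i, j), ⟨h1, by simp only [Set.mem_Iic]; omega⟩, rfl⟩
  · intro i hi
    constructor
    · intro hM
      have := hM 1 (by rw [N_child1, mem_TT]; exact Or.inr hi)
      rw [N_child1] at this
      obtain ⟨i', j', he, h1, h2⟩ := this
      obtain ⟨rfl, rfl⟩ := N_inj he
      rcases h2 with h2 | h2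
      · omega
      · exact h2.2.2
    · rintro he k ⟨i', j', hk, _⟩
      rw [hk]
      rcases N_child hk with ⟨rfl, rfl, _⟩ | ⟨rfl, rfl⟩
      · exact ⟨_, _, rfl, by omega, Or.inl rfl⟩
      · exact ⟨_, _, rfl, by omega, Or.inr ⟨rfl, hi, he⟩⟩

theorem psi_set {AP : Type} (n : ℕ) :
    (∃ V1 V2, Sat (weakDom MSOdom) (KT AP (fun i => i = n)) V1 V2 fPsi) ↔ Even (n + 1) := by
  rw [psi_even (by omega) (br_eq n)]
  refine ⟨fun ⟨_, _, _, h⟩ => h, fun h => ?_⟩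
  refine ⟨{x | ∃ i, x = N (i+1) 0 ∧ i ≤ n ∧ Even i}, ⟨?_, ?_⟩, ?_, h⟩
  · rintro x ⟨i, rfl, _⟩
    rw [mem_TT]; exact Or.inl rfl
  · apply Set.Finite.subset ((Set.finite_Iic n).image (fun p : ℕ => N (p + 1) 0))
    rintro x ⟨i, rfl, h1, h2⟩
    exact ⟨i, h1, rfl⟩
  · intro i hi
    constructor
    · intro hM
      have := hM 0 (by rw [N_child0, mem_TT]; exact Or.inl rfl)
      rw [N_child0] at this
      obtain ⟨i', he, h1, h2⟩ := this
      obtain ⟨e, _⟩ := N_inj he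
      obtain rfl : i = i' := by omega
      exact h2
    · rintro he k ⟨i', j', hk, hq⟩
      rw [hk]
      rcases N_child hk with ⟨rfl, rfl, _⟩ | ⟨rfl, rfl⟩
      · exact ⟨_, rfl, by omega, he⟩
      · exfalso
        have : i' = n := by omega
        subst this
        rw [Nat.even_add_one] at h
        exact h he

end Aux8

/-- over finitely-branching Kripke trees, WMPL < WMTL < WMSO. -/
theorem stmt8 (AP : Type) [Fintype AP] :
    MLogic.Lt (finBrKT AP) (WMPL AP) (WMTL AP) ∧
    MLogic.Lt (finBrKT AP) (WMTL AP) (WMSO AP) := by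
  refine ⟨⟨Aux8.leq1 _, ?_⟩, ⟨Aux8.leq2 _, ?_⟩⟩
  · refine Aux8.not_leq_of (Or.inl rfl) Aux8.dom_path Aux8.fPsi Aux8.fPsi_sentence ?_
    intro n hn
    rw [Aux8.psi_tree n hn, Aux8.psi_tree (n+1) (by omega), Nat.even_add_one, not_not]
  · refine Aux8.not_leq_of (Or.inr rfl) Aux8.dom_tree Aux8.fPsi Aux8.fPsi_sentence ?_
    intro n hn
    rw [Aux8.psi_set n, Aux8.psi_set (n+1), Nat.even_add_one (n := n + 1), not_not]
end
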